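/- arXiv:2112.08897 — 4 statements merged into one kernel-verified Lean document; each statement's English description precedes it below -/
import Mathlib

section
/- Let Λ be a finite-dimensional algebra over a field k and let C be any class of finitely generated Λ-modules. Then Filt(Fac(C)) is a torsion class in the category of finitely generated Λ-modules (i.e., it is closed under quotient modules, finite direct sums, and extensions), and dually Filt(Sub(C)) is a torsion-free class (closed under submodules, finite direct sums, and extensions). -/
open scoped TensorProduct

namespace Paper

/-! ### Torsion-theoretic notions over an arbitrary ring -/

section Torsion

variable (R : Type) [Ring R]

/-- `FacCl R C` : quotient modules of finite direct sums of modules in `C`. -/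
def FacCl (C : ModuleCat.{0} R → Prop) (M : ModuleCat.{0} R) : Prop :=
  ∃ (n : ℕ) (N : Fin n → ModuleCat.{0} R), (∀ i, C (N i)) ∧
    ∃ f : ((i : Fin n) → N i) →ₗ[R] M, Function.Surjective f

/-- `SubCl R C` : submodules of finite direct sums of modules in `C`. -/
def SubCl (C : ModuleCat.{0} R → Prop) (M : ModuleCat.{0} R) : Prop :=
  ∃ (n : ℕ) (N : Fin n → ModuleCat.{0} R), (∀ i, C (N i)) ∧
    ∃ f : M →ₗ[R] ((i : Fin n) → N i), Function.Injective f

/-- `AddCl R C` : direct summands of finite direct sums of modules in `C`. -/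
def AddCl (C : ModuleCat.{0} R → Prop) (M : ModuleCat.{0} R) : Prop :=
  ∃ (n : ℕ) (N : Fin n → ModuleCat.{0} R), (∀ i, C (N i)) ∧
    ∃ (s : M →ₗ[R] ((i : Fin n) → N i)) (r : ((i : Fin n) → N i) →ₗ[R] M),
      ∀ m : M, r (s m) = m

/-- `FiltCl R C` : modules having a finite filtration with subquotients in `add C`. -/
def FiltCl (C : ModuleCat.{0} R → Prop) (M : ModuleCat.{0} R) : Prop :=
  ∃ (l : ℕ) (F : Fin (l + 1) → Submodule R M),
    Monotone F ∧ F 0 = ⊥ ∧ F (Fin.last l) = ⊤ ∧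
      ∀ i : Fin l, AddCl R C (ModuleCat.of R
        (↥(F i.succ) ⧸ Submodule.comap (F i.succ).subtype (F i.castSucc)))

/-- A torsion class inside the ambient class `Amb` of modules:  a subclass of `Amb`
closed under quotient modules, finite direct sums and extensions. -/
def IsTorsionClassIn (Amb T : ModuleCat.{0} R → Prop) : Prop :=
  (∀ M, T M → Amb M) ∧
  (∀ (M N : ModuleCat.{0} R) (f : M →ₗ[R] N),
      Amb N → Function.Surjective f → T M → T N) ∧
  (∀ (n : ℕ) (N : Fin n → ModuleCat.{0} R), (∀ i, T (N i)) →
      Amb (ModuleCat.of R ((i : Fin n) → N i)) →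
      T (ModuleCat.of R ((i : Fin n) → N i))) ∧
  (∀ (M : ModuleCat.{0} R) (A : Submodule R M), Amb M →
      T (ModuleCat.of R ↥A) → T (ModuleCat.of R (↥M ⧸ A)) → T M)

/-- A torsion-free class inside the ambient class `Amb` of modules. -/
def IsTorsionFreeClassIn (Amb F : ModuleCat.{0} R → Prop) : Prop :=
  (∀ M, F M → Amb M) ∧
  (∀ (M N : ModuleCat.{0} R) (f : M →ₗ[R] N),
      Amb M → Function.Injective f → F N → F M) ∧
  (∀ (n : ℕ) (N : Fin n → ModuleCat.{0} R), (∀ i, F (N i)) →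
      Amb (ModuleCat.of R ((i : Fin n) → N i)) →
      F (ModuleCat.of R ((i : Fin n) → N i))) ∧
  (∀ (M : ModuleCat.{0} R) (A : Submodule R M), Amb M →
      F (ModuleCat.of R ↥A) → F (ModuleCat.of R (↥M ⧸ A)) → F M)

/-- The smallest torsion class (inside `Amb`) containing the class `C`. -/
def TorsClIn (Amb C : ModuleCat.{0} R → Prop) (M : ModuleCat.{0} R) : Prop :=
  ∀ T : ModuleCat.{0} R → Prop, IsTorsionClassIn R Amb T →
    (∀ X, Amb X → C X → T X) → T M

/-- The smallest torsion-free class (inside `Amb`) containing the class `C`. -/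
def TorfClIn (Amb C : ModuleCat.{0} R → Prop) (M : ModuleCat.{0} R) : Prop :=
  ∀ F : ModuleCat.{0} R → Prop, IsTorsionFreeClassIn R Amb F →
    (∀ X, Amb X → C X → F X) → F M

/-- The ambient class of finitely generated modules. -/
def FGMod (M : ModuleCat.{0} R) : Prop := Module.Finite R M

def ContravariantlyFinite (Amb C : ModuleCat.{0} R → Prop) : Prop :=
  ∀ M : ModuleCat.{0} R, Amb M →
    ∃ X : ModuleCat.{0} R, C X ∧ ∃ f : X →ₗ[R] M,
      ∀ Y : ModuleCat.{0} R, C Y → ∀ g : Y →ₗ[R] M,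
        ∃ h : Y →ₗ[R] X, ∀ y : Y, f (h y) = g y

def CovariantlyFinite (Amb C : ModuleCat.{0} R → Prop) : Prop :=
  ∀ M : ModuleCat.{0} R, Amb M →
    ∃ X : ModuleCat.{0} R, C X ∧ ∃ f : M →ₗ[R] X,
      ∀ Y : ModuleCat.{0} R, C Y → ∀ g : M →ₗ[R] Y,
        ∃ h : X →ₗ[R] Y, ∀ m : M, h (f m) = g m

def FunctoriallyFinite (Amb C : ModuleCat.{0} R → Prop) : Prop :=
  ContravariantlyFinite R Amb C ∧ CovariantlyFinite R Amb C

/-- `M` is (isomorphic to) a direct summand of `W`. -/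
def IsSummandOf (X W : Type) [AddCommGroup X] [Module R X]
    [AddCommGroup W] [Module R W] : Prop :=
  ∃ (s : X →ₗ[R] W) (r : W →ₗ[R] X), ∀ x : X, r (s x) = x

/-- An indecomposable module: nonzero and not the direct sum of two nonzero submodules. -/
def IndecMod (M : Type) [AddCommGroup M] [Module R M] : Prop :=
  Nontrivial M ∧ ∀ A B : Submodule R M, IsCompl A B → A = ⊥ ∨ B = ⊥

/-- A projective cover: a surjection from a projective module with superfluous kernel. -/
def IsProjCover {P V : Type} [AddCommGroup P] [Module R P]
    [AddCommGroup V] [Module R V] (π : P →ₗ[R] V) : Prop :=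
  Module.Projective R P ∧ Function.Surjective π ∧
    ∀ L : Submodule R P, LinearMap.ker π ⊔ L = ⊤ → L = ⊤

/-- An injective envelope: an injection into an injective module with essential image. -/
def IsInjEnv {V I : Type} [AddCommGroup V] [Module R V]
    [AddCommGroup I] [Module R I] (ι : V →ₗ[R] I) : Prop :=
  Module.Injective R I ∧ Function.Injective ι ∧
    ∀ L : Submodule R I, L ≠ ⊥ → L ⊓ LinearMap.range ι ≠ ⊥

/-- A central idempotent. -/
def IsCentralIdem (b : R) : Prop :=
  b * b = b ∧ ∀ a : R, a * b = b * a

/-- A block idempotent: a primitive idempotent of the center. -/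
def IsBlockIdem (b : R) : Prop :=
  b ≠ 0 ∧ IsCentralIdem R b ∧
    ∀ c d : R, IsCentralIdem R c → IsCentralIdem R d →
      c * d = 0 → d * c = 0 → b = c + d → c = 0 ∨ d = 0

/-- The module `U` lies in the block determined by the central idempotent `b`. -/
def LiesIn (b : R) (U : Type) [AddCommGroup U] [Module R U] : Prop :=
  ∀ u : U, b • u = u

/-- The `b`-component `b·M` of a module `M`, for a central idempotent `b`. -/
def blockComp (b : R) (hb : ∀ a : R, a * b = b * a)
    (M : Type) [AddCommGroup M] [Module R M] : Submodule R M where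
  carrier := {m : M | b • m = m}
  add_mem' := by
    intro x y hx hy
    simp only [Set.mem_setOf_eq] at *
    rw [smul_add, hx, hy]
  zero_mem' := by simp
  smul_mem' := by
    intro c m hm
    simp only [Set.mem_setOf_eq] at *
    rw [smul_smul, ← hb c, mul_smul, hm]

/-- The ambient class of finitely generated modules lying in the block of `b`. -/
def BlockFG (b : R) : ModuleCat.{0} R → Prop :=
  fun M => Module.Finite R M ∧ LiesIn R b M

end Torsion

/-! ### Bundled modules with a compatible `k`-structure -/

structure BModule (k R : Type) [CommSemiring k] [Ring R] [Algebra k R] : Type 1 where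
  carrier : Type
  [isAddCommGroup : AddCommGroup carrier]
  [isModuleK : Module k carrier]
  [isModuleR : Module R carrier]
  [isTower : IsScalarTower k R carrier]

attribute [instance] BModule.isAddCommGroup BModule.isModuleK BModule.isModuleR
  BModule.isTower

instance (k R : Type) [CommSemiring k] [Ring R] [Algebra k R] :
    CoeSort (BModule k R) Type :=
  ⟨BModule.carrier⟩

section GroupAlg

variable (k : Type) [Field k]

/-- A brick over a `k`-algebra `R`: a nonzero module all of whose `R`-endomorphisms
are given by scalars in `k`. -/
def IsBrickOver (R : Type) [Ring R] [Algebra k R]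
    (U : Type) [AddCommGroup U] [Module R U] : Prop :=
  Nontrivial U ∧ ∀ f : U →ₗ[R] U, ∃ c : k, ∀ u : U, f u = algebraMap k R c • u

/-- A module which is a finite direct sum of bricks with no nonzero homomorphisms
between non-isomorphic summands. -/
def IsSemibrickModule (R : Type) [Ring R] [Algebra k R]
    (M : Type) [AddCommGroup M] [Module R M] : Prop :=
  ∃ (m : ℕ) (T : Fin m → BModule k R),
    Nonempty (M ≃ₗ[R] ((i : Fin m) → ↥(T i))) ∧
    (∀ i, IsBrickOver k R ↥(T i)) ∧
    ∀ i j, IsEmpty (↥(T i) ≃ₗ[R] ↥(T j)) → ∀ f : ↥(T i) →ₗ[R] ↥(T j), f = 0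

/-- `V` is one-dimensional over `k`. -/
def OneDimOver (V : Type) [AddCommGroup V] [Module k V] : Prop :=
  ∃ v : V, v ≠ 0 ∧ ∀ w : V, ∃ c : k, w = c • v

/-- Triviality of the second group cohomology `H²(Q, kˣ)` (trivial action):
every `2`-cocycle is a `2`-coboundary. -/
def H2Trivial (Q : Type) [Group Q] : Prop :=
  ∀ α : Q → Q → kˣ,
    (∀ a b c : Q, α a b * α (a * b) c = α b c * α a (b * c)) →
    ∃ β : Q → kˣ, ∀ a b : Q, α a b = β a * β b * (β (a * b))⁻¹

/-- The `k`-algebra `R` is basic (for `k` algebraically closed this means that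
every simple module is one-dimensional over `k`). -/
def BasicAlg (R : Type) [Ring R] [Algebra k R] : Prop :=
  ∀ V : BModule k R, IsSimpleModule R ↥V → OneDimOver k ↥V

/-- `P` has exactly `n` isomorphism classes of modules satisfying it. -/
def RepClasses (R : Type) [Ring R] [Algebra k R]
    (P : BModule k R → Prop) (n : ℕ) : Prop :=
  ∃ V : Fin n → BModule k R, (∀ i, P (V i)) ∧
    (∀ i j, i ≠ j → IsEmpty (↥(V i) ≃ₗ[R] ↥(V j))) ∧
    ∀ W : BModule k R, P W → ∃ i, Nonempty (↥W ≃ₗ[R] ↥(V i))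

/-- The ring homomorphism `k[A] → k[B]` induced by a group homomorphism `f : A → B`. -/
noncomputable def MapAlong {A B : Type} [Group A] [Group B] (f : A →* B) :
    MonoidAlgebra k A →+* MonoidAlgebra k B :=
  MonoidAlgebra.mapDomainRingHom k f

/-- The `k[B]`-module `W` restricted along `f : A → B` is isomorphic to the
`k[A]`-module `U`; i.e. `W` is an extending module of `U`. -/
def ExtendsAlong {A B : Type} [Group A] [Group B] (f : A →* B)
    (U : Type) [AddCommGroup U] [Module (MonoidAlgebra k A) U]
    (W : Type) [AddCommGroup W] [Module (MonoidAlgebra k B) W] : Prop :=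
  ∃ φ : U ≃+ W, ∀ (a : MonoidAlgebra k A) (u : U),
    φ (a • u) = MapAlong k f a • φ u

/-- `η : U →+ W` exhibits the `k[B]`-module `W` as the module induced along
`f : A → B` from the `k[A]`-module `U`: `η` is `k[A]`-linear into the restriction
of `W`, and has the universal (left-adjoint) property. -/
def IsInducedUnit {A B : Type} [Group A] [Group B] (f : A →* B)
    (U : Type) [AddCommGroup U] [Module (MonoidAlgebra k A) U]
    (W : Type) [AddCommGroup W] [Module (MonoidAlgebra k B) W]
    (η : U →+ W) : Prop :=
  (∀ (a : MonoidAlgebra k A) (u : U), η (a • u) = MapAlong k f a • η u) ∧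
  ∀ (X : BModule k (MonoidAlgebra k B)) (g : U →+ ↥X),
    (∀ (a : MonoidAlgebra k A) (u : U), g (a • u) = MapAlong k f a • g u) →
    ∃! F : W →ₗ[MonoidAlgebra k B] ↥X, ∀ u : U, F (η u) = g u

/-- `W` is (a realization of) the induced module `Ind` of `U` along `f`. -/
def IsInducedAlong {A B : Type} [Group A] [Group B] (f : A →* B)
    (U : Type) [AddCommGroup U] [Module (MonoidAlgebra k A) U]
    (W : Type) [AddCommGroup W] [Module (MonoidAlgebra k B) W] : Prop :=
  ∃ η : U →+ W, IsInducedUnit k f U W η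

variable (Gt : Type) [Group Gt] (G : Subgroup Gt) [G.Normal]

/-- Conjugation `g ↦ x⁻¹ g x` as a homomorphism of the normal subgroup `G`. -/
def conjHom (x : Gt) : ↥G →* ↥G where
  toFun g := ⟨x⁻¹ * ↑g * x, ‹G.Normal›.conj_mem' (↑g) g.2 x⟩
  map_one' := by
    apply Subtype.ext
    simp
  map_mul' g h := by
    apply Subtype.ext
    push_cast
    group

/-- The `kG`-module `U` is stable under conjugation by `x`, i.e. `ˣU ≅ U`. -/
def IsStableAt (x : Gt) (U : Type) [AddCommGroup U]
    [Module (MonoidAlgebra k ↥G) U] : Prop :=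
  ∃ ψ : U ≃+ U, ∀ (a : MonoidAlgebra k ↥G) (u : U),
    ψ (MapAlong k (conjHom Gt G x) a • u) = a • ψ u

/-- The `kG`-module `U` is `G̃`-stable. -/
def IsGtStable (U : Type) [AddCommGroup U]
    [Module (MonoidAlgebra k ↥G) U] : Prop :=
  ∀ x : Gt, IsStableAt k Gt G x U

/-- The inertia group of an element `b ∈ kG` inside `G̃`:
all `x ∈ G̃` with `x b x⁻¹ = b`. -/
def inertia (b : MonoidAlgebra k ↥G) : Subgroup Gt where
  carrier := {x : Gt | Commute (MonoidAlgebra.of k Gt x) (MapAlong k G.subtype b)}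
  one_mem' := by
    simp only [Set.mem_setOf_eq, map_one]
    exact Commute.one_left _
  mul_mem' := by
    intro a c ha hc
    simp only [Set.mem_setOf_eq, map_mul] at *
    exact ha.mul_left hc
  inv_mem' := by
    intro a ha
    simp only [Set.mem_setOf_eq] at *
    have h1 : MonoidAlgebra.of k Gt a⁻¹ * MonoidAlgebra.of k Gt a = 1 := by
      rw [← map_mul, inv_mul_cancel, map_one]
    have h2 : MonoidAlgebra.of k Gt a * MonoidAlgebra.of k Gt a⁻¹ = 1 := by
      rw [← map_mul, mul_inv_cancel, map_one]
    show MonoidAlgebra.of k Gt a⁻¹ * MapAlong k G.subtype b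
        = MapAlong k G.subtype b * MonoidAlgebra.of k Gt a⁻¹
    calc MonoidAlgebra.of k Gt a⁻¹ * MapAlong k G.subtype b
        = MonoidAlgebra.of k Gt a⁻¹ * MapAlong k G.subtype b *
            (MonoidAlgebra.of k Gt a * MonoidAlgebra.of k Gt a⁻¹) := by
          rw [h2, mul_one]
      _ = MonoidAlgebra.of k Gt a⁻¹ * (MapAlong k G.subtype b * MonoidAlgebra.of k Gt a) *
            MonoidAlgebra.of k Gt a⁻¹ := by noncomm_ring
      _ = MonoidAlgebra.of k Gt a⁻¹ * (MonoidAlgebra.of k Gt a * MapAlong k G.subtype b) *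
            MonoidAlgebra.of k Gt a⁻¹ := by rw [← ha.eq]
      _ = (MonoidAlgebra.of k Gt a⁻¹ * MonoidAlgebra.of k Gt a) *
            (MapAlong k G.subtype b * MonoidAlgebra.of k Gt a⁻¹) := by noncomm_ring
      _ = MapAlong k G.subtype b * MonoidAlgebra.of k Gt a⁻¹ := by
          rw [h1, one_mul]

/-- Relative projectivity of a `k[A]`-module with respect to a subgroup `D ≤ A`:
any `k[A]`-linear surjection onto a quotient admitting a `k[D]`-linear splitting of
a lifting problem admits a `k[A]`-linear solution. -/
def RelProj (A : Type) [Group A] (D : Subgroup A)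
    (U : Type) [AddCommGroup U] [Module (MonoidAlgebra k A) U] : Prop :=
  ∀ (M N : BModule k (MonoidAlgebra k A))
    (f : ↥M →ₗ[MonoidAlgebra k A] ↥N) (g : U →ₗ[MonoidAlgebra k A] ↥N),
    Function.Surjective f →
    (∃ h : U →+ ↥M,
        (∀ (c : k) (u : U),
          h (algebraMap k (MonoidAlgebra k A) c • u)
            = algebraMap k (MonoidAlgebra k A) c • h u) ∧
        (∀ (d : ↥D) (u : U),
          h (MonoidAlgebra.of k A ↑d • u) = MonoidAlgebra.of k A ↑d • h u) ∧
        ∀ u : U, f (h u) = g u) →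
    ∃ h' : U →ₗ[MonoidAlgebra k A] ↥M, ∀ u : U, f (h' u) = g u

/-- `D` is a defect group of the block of `b`: `D` is minimal with respect to
inclusion among subgroups such that every module in the block is relatively
`D`-projective. -/
def IsDefectGroup (A : Type) [Group A] (b : MonoidAlgebra k A)
    (D : Subgroup A) : Prop :=
  (∀ U : BModule k (MonoidAlgebra k A),
      LiesIn (MonoidAlgebra k A) b ↥U → RelProj k A D ↥U) ∧
  ∀ D' : Subgroup A, D' ≤ D →
    (∀ U : BModule k (MonoidAlgebra k A),
        LiesIn (MonoidAlgebra k A) b ↥U → RelProj k A D' ↥U) →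
    D' = D

/-- Left finiteness (inside the ambient class `Amb`) of a module `S`: the smallest
torsion class containing `S` is functorially finite. -/
def IsLeftFiniteIn (R : Type) [Ring R] (Amb : ModuleCat.{0} R → Prop)
    (S : Type) [AddCommGroup S] [Module R S] : Prop :=
  FunctoriallyFinite R Amb (TorsClIn R Amb (fun X => Nonempty (↥X ≃ₗ[R] S)))

/-- `W₂` realizes the tensor product `W₁ ⊗ₖ V` with the diagonal `G̃`-action, where
`V` is a `k[G̃/G]`-module viewed as a `k[G̃]`-module via the projection. -/
def DiagTensorIso
    (W₁ : Type) [AddCommGroup W₁] [Module k W₁] [Module (MonoidAlgebra k Gt) W₁]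
    [IsScalarTower k (MonoidAlgebra k Gt) W₁]
    (V : Type) [AddCommGroup V] [Module k V] [Module (MonoidAlgebra k (Gt ⧸ G)) V]
    [IsScalarTower k (MonoidAlgebra k (Gt ⧸ G)) V]
    (W₂ : Type) [AddCommGroup W₂] [Module k W₂] [Module (MonoidAlgebra k Gt) W₂]
    [IsScalarTower k (MonoidAlgebra k Gt) W₂] : Prop :=
  ∃ θ : (W₁ ⊗[k] V) ≃ₗ[k] W₂,
    ∀ (x : Gt) (w : W₁) (v : V),
      θ ((MonoidAlgebra.of k Gt x • w) ⊗ₜ[k]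
          (MonoidAlgebra.of k (Gt ⧸ G) (QuotientGroup.mk x) • v))
        = MonoidAlgebra.of k Gt x • θ (w ⊗ₜ[k] v)

end GroupAlg

/-! ### Filtrations as chains of submodules -/

section Filtrations

variable {R : Type} [Ring R]

/-- `FiltStep D A B` : `A ≤ B` and the subquotient `B / A` lies in `add D`. -/
def FiltStep (D : ModuleCat.{0} R → Prop) {M : Type} [AddCommGroup M] [Module R M]
    (A B : Submodule R M) : Prop :=
  A ≤ B ∧ AddCl R D (ModuleCat.of R (↥B ⧸ Submodule.comap B.subtype A))

lemma filtCl_iff_reflTransGen {D : ModuleCat.{0} R → Prop} {M : ModuleCat.{0} R} :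
    FiltCl R D M ↔
      Relation.ReflTransGen (FiltStep D) (⊥ : Submodule R M) ⊤ := by
  constructor
  · rintro ⟨l, F, hF, h0, hl, hs⟩
    have key : ∀ i : Fin (l + 1), Relation.ReflTransGen (FiltStep D) (F 0) (F i) := by
      intro i
      induction i using Fin.induction with
      | zero => exact .refl
      | succ i ih => exact ih.tail ⟨hF (Fin.castSucc_lt_succ).le, hs i⟩
    simpa only [h0, hl] using key (Fin.last l)
  · intro h
    suffices ∀ B : Submodule R M, Relation.ReflTransGen (FiltStep D) ⊥ B →
        ∃ (l : ℕ) (F : Fin (l + 1) → Submodule R M), F 0 = ⊥ ∧ F (Fin.last l) = B ∧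
          ∀ i : Fin l, FiltStep D (F i.castSucc) (F i.succ) by
      obtain ⟨l, F, h0, hl, hs⟩ := this _ h
      exact ⟨l, F, Fin.monotone_iff_le_succ.2 fun i => (hs i).1, h0, hl, fun i => (hs i).2⟩
    intro B hB
    induction hB with
    | refl => exact ⟨0, fun _ => ⊥, rfl, rfl, fun i => i.elim0⟩
    | @tail A B _ hAB ih =>
      obtain ⟨l, F, h0, hl, hs⟩ := ih
      refine ⟨l + 1, Fin.snoc (α := fun _ => Submodule R M) F B, ?_, ?_, ?_⟩
      · rw [← Fin.castSucc_zero, Fin.snoc_castSucc, h0]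
      · rw [Fin.snoc_last]
      · intro i
        induction i using Fin.lastCases with
        | last => rwa [Fin.snoc_castSucc, Fin.succ_last, Fin.snoc_last, hl]
        | cast i =>
          rw [Fin.snoc_castSucc, Fin.succ_castSucc, Fin.snoc_castSucc]
          exact hs i

section SubquotientMap

variable {M N : Type} [AddCommGroup M] [Module R M] [AddCommGroup N] [Module R N]
  {A B : Submodule R M} {A' B' : Submodule R N}

/-- The map `B / A → B' / A'` induced by a linear map sending `A` to `A'` and `B` to `B'`. -/
def subquotientMap (f : M →ₗ[R] N) (hA : A ≤ A'.comap f) (hB : B ≤ B'.comap f) :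
    (↥B ⧸ A.comap B.subtype) →ₗ[R] (↥B' ⧸ A'.comap B'.subtype) :=
  Submodule.mapQ _ _ (f.restrict hB) (by intro x hx; exact hA hx)

lemma subquotientMap_injective (f : M →ₗ[R] N) (hA : A ≤ A'.comap f) (hB : B ≤ B'.comap f)
    (h : B ⊓ A'.comap f ≤ A) : Function.Injective (subquotientMap f hA hB) := by
  rw [injective_iff_map_eq_zero]
  intro x
  obtain ⟨x, rfl⟩ := Submodule.Quotient.mk_surjective _ x
  intro hx
  change Submodule.Quotient.mk (f.restrict hB x) = 0 at hx
  rw [Submodule.Quotient.mk_eq_zero] at hx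
  rw [Submodule.Quotient.mk_eq_zero]
  exact h ⟨x.2, hx⟩

lemma subquotientMap_surjective (f : M →ₗ[R] N) (hA : A ≤ A'.comap f) (hB : B ≤ B'.comap f)
    (h : B' ≤ B.map f) : Function.Surjective (subquotientMap f hA hB) := by
  intro y
  obtain ⟨⟨y, hy⟩, rfl⟩ := Submodule.Quotient.mk_surjective _ y
  obtain ⟨x, hx, rfl⟩ := h hy
  exact ⟨Submodule.Quotient.mk ⟨x, hx⟩, rfl⟩

end SubquotientMap

lemma AddCl.of_linearEquiv {D : ModuleCat.{0} R → Prop} {M N : ModuleCat.{0} R}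
    (h : AddCl R D M) (e : M ≃ₗ[R] N) : AddCl R D N := by
  obtain ⟨n, K, hK, s, r, hsr⟩ := h
  exact ⟨n, K, hK, s ∘ₗ e.symm.toLinearMap, e.toLinearMap ∘ₗ r, fun x => by simp [hsr]⟩

lemma AddCl.of_mem {D : ModuleCat.{0} R → Prop} {M : ModuleCat.{0} R} (h : D M) :
    AddCl R D M :=
  ⟨1, fun _ => M, fun _ => h, LinearMap.pi fun _ => LinearMap.id, LinearMap.proj 0,
    fun _ => rfl⟩

lemma FiltStep.map_of_injective {D : ModuleCat.{0} R → Prop} {M N : Type} [AddCommGroup M]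
    [Module R M] [AddCommGroup N] [Module R N] {A B : Submodule R M} (h : FiltStep D A B)
    {f : M →ₗ[R] N} (hf : Function.Injective f) : FiltStep D (A.map f) (B.map f) := by
  refine ⟨Submodule.map_mono h.1, h.2.of_linearEquiv (LinearEquiv.ofBijective
    (subquotientMap f (Submodule.le_comap_map f A) (Submodule.le_comap_map f B))
    ⟨subquotientMap_injective _ _ _ ?_, subquotientMap_surjective _ _ _ le_rfl⟩)⟩
  rw [Submodule.comap_map_eq_of_injective hf]
  exact inf_le_right

lemma FiltStep.comap_of_surjective {D : ModuleCat.{0} R → Prop} {M N : Type} [AddCommGroup M]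
    [Module R M] [AddCommGroup N] [Module R N] {A B : Submodule R N} (h : FiltStep D A B)
    {f : M →ₗ[R] N} (hf : Function.Surjective f) : FiltStep D (A.comap f) (B.comap f) := by
  refine ⟨Submodule.comap_mono h.1, h.2.of_linearEquiv (LinearEquiv.ofBijective
    (subquotientMap f le_rfl le_rfl)
    ⟨subquotientMap_injective _ _ _ inf_le_right, subquotientMap_surjective _ _ _ ?_⟩).symm⟩
  rw [Submodule.map_comap_eq_of_surjective hf]

/-- `Filt D` is closed under extensions. -/
lemma FiltCl.of_extension {D : ModuleCat.{0} R → Prop} {M : ModuleCat.{0} R}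
    (A : Submodule R M) (hA : FiltCl R D (ModuleCat.of R ↥A))
    (hQ : FiltCl R D (ModuleCat.of R (↥M ⧸ A))) : FiltCl R D M := by
  rw [filtCl_iff_reflTransGen] at hA hQ ⊢
  have h₁ := hA.lift (p := FiltStep D) (Submodule.map A.subtype)
    fun _ _ h => h.map_of_injective A.subtype_injective
  have h₂ := hQ.lift (p := FiltStep D) (Submodule.comap A.mkQ)
    fun _ _ h => h.comap_of_surjective A.mkQ_surjective
  simp only [Function.onFun, Submodule.map_bot, Submodule.map_top, Submodule.range_subtype] at h₁
  simp only [Function.onFun, Submodule.comap_bot, Submodule.comap_top, Submodule.ker_mkQ] at h₂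
  exact h₁.trans h₂

lemma FiltCl.of_linearEquiv {D : ModuleCat.{0} R → Prop} {M N : ModuleCat.{0} R}
    (h : FiltCl R D M) (e : M ≃ₗ[R] N) : FiltCl R D N := by
  rw [filtCl_iff_reflTransGen] at h ⊢
  have := h.lift (p := FiltStep D) (Submodule.map e.toLinearMap)
    fun _ _ h => h.map_of_injective e.injective
  simpa [Function.onFun, Submodule.map_top, LinearMap.range_eq_top.2 e.surjective] using this

lemma FiltCl.of_subsingleton {D : ModuleCat.{0} R → Prop} {M : ModuleCat.{0} R}
    [Subsingleton M] : FiltCl R D M := by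
  rw [filtCl_iff_reflTransGen, Subsingleton.elim (⊥ : Submodule R M) ⊤]

/-- `Filt D` is closed under finite direct sums. -/
lemma FiltCl.pi {D : ModuleCat.{0} R → Prop} (n : ℕ) (N : Fin n → ModuleCat.{0} R)
    (h : ∀ i, FiltCl R D (N i)) : FiltCl R D (ModuleCat.of R ((i : Fin n) → N i)) := by
  induction n with
  | zero => exact .of_subsingleton
  | succ n ih =>
    let p : ((i : Fin (n + 1)) → N i) →ₗ[R] N 0 := LinearMap.proj 0
    let q : ↥(LinearMap.ker p) →ₗ[R] ((i : Fin n) → N i.succ) :=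
      (LinearMap.pi fun i => LinearMap.proj i.succ) ∘ₗ (LinearMap.ker p).subtype
    have hp : Function.Surjective p := fun x => ⟨Fin.cons x 0, rfl⟩
    have hq : Function.Bijective q := by
      constructor
      · rw [injective_iff_map_eq_zero]
        intro x hx
        ext i
        induction i using Fin.cases with
        | zero => exact x.2
        | succ i => exact congrFun hx i
      · exact fun x => ⟨⟨Fin.cons 0 x, by simp [p]⟩, rfl⟩
    exact .of_extension (M := ModuleCat.of R ((i : Fin (n + 1)) → N i)) (LinearMap.ker p)
      ((ih _ fun i => h i.succ).of_linearEquiv (LinearEquiv.ofBijective q hq).symm)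
      ((h 0).of_linearEquiv (p.quotKerEquivOfSurjective hp).symm)

/-- If every module in `add D` is finitely generated, so is every module in `Filt D`. -/
lemma FiltCl.finite {D : ModuleCat.{0} R → Prop} (hD : ∀ X, AddCl R D X → Module.Finite R X)
    {M : ModuleCat.{0} R} (h : FiltCl R D M) : Module.Finite R M := by
  rw [filtCl_iff_reflTransGen] at h
  suffices ∀ B : Submodule R M, Relation.ReflTransGen (FiltStep D) ⊥ B → Module.Finite R B from
    have := this _ h
    Module.Finite.equiv (Submodule.topEquiv (R := R) (M := M))
  intro B hB
  induction hB with
  | refl => infer_instance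
  | @tail A B _ hAB ih =>
    have := hD _ hAB.2
    have : Module.Finite R ↥(A.comap B.subtype) :=
      Module.Finite.equiv (Submodule.comapSubtypeEquivOfLe hAB.1).symm
    exact Module.Finite.of_submodule_quotient (A.comap B.subtype)

end Filtrations

section FacSub

variable {R : Type} [Ring R] {C : ModuleCat.{0} R → Prop}

lemma FacCl.of_surjective {M N : ModuleCat.{0} R} (h : FacCl R C M) {f : M →ₗ[R] N}
    (hf : Function.Surjective f) : FacCl R C N := by
  obtain ⟨n, K, hK, g, hg⟩ := h
  exact ⟨n, K, hK, f ∘ₗ g, hf.comp hg⟩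

lemma SubCl.of_injective {M N : ModuleCat.{0} R} (h : SubCl R C N) {f : M →ₗ[R] N}
    (hf : Function.Injective f) : SubCl R C M := by
  obtain ⟨n, K, hK, g, hg⟩ := h
  exact ⟨n, K, hK, g ∘ₗ f, hg.comp hf⟩

lemma FacCl.pi_of_fintype {ι : Type} [Fintype ι] (N : ι → ModuleCat.{0} R) (h : ∀ i, C (N i)) :
    FacCl R C (ModuleCat.of R ((i : ι) → N i)) :=
  let e := (Fintype.equivFin ι).symm
  ⟨_, fun i => N (e i), fun i => h (e i),
    (LinearEquiv.piCongrLeft R (fun i => N i) e).toLinearMap, LinearEquiv.surjective _⟩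

lemma SubCl.pi_of_fintype {ι : Type} [Fintype ι] (N : ι → ModuleCat.{0} R) (h : ∀ i, C (N i)) :
    SubCl R C (ModuleCat.of R ((i : ι) → N i)) :=
  let e := (Fintype.equivFin ι).symm
  ⟨_, fun i => N (e i), fun i => h (e i),
    (LinearEquiv.piCongrLeft R (fun i => N i) e).symm.toLinearMap, LinearEquiv.injective _⟩

lemma addCl_facCl_iff {M : ModuleCat.{0} R} : AddCl R (FacCl R C) M ↔ FacCl R C M := by
  refine ⟨?_, AddCl.of_mem⟩
  rintro ⟨n, N, hN, s, r, hsr⟩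
  choose m K hK f hf using hN
  let g : ((p : (i : Fin n) × Fin (m i)) → K p.1 p.2) →ₗ[R] ((i : Fin n) → N i) :=
    (LinearMap.pi fun i => f i ∘ₗ LinearMap.proj i) ∘ₗ
      (LinearEquiv.piCurry R fun i j => K i j).toLinearMap
  have hg : Function.Surjective g :=
    (Function.Surjective.piMap hf).comp (LinearEquiv.piCurry R fun i j => K i j).surjective
  exact (FacCl.pi_of_fintype (fun p : (i : Fin n) × Fin (m i) => K p.1 p.2)
    fun p => hK p.1 p.2).of_surjective (f := r ∘ₗ g)
    ((Function.LeftInverse.surjective hsr).comp hg)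

lemma addCl_subCl_iff {M : ModuleCat.{0} R} : AddCl R (SubCl R C) M ↔ SubCl R C M := by
  refine ⟨?_, AddCl.of_mem⟩
  rintro ⟨n, N, hN, s, r, hsr⟩
  choose m K hK f hf using hN
  let g : ((i : Fin n) → N i) →ₗ[R] ((p : (i : Fin n) × Fin (m i)) → K p.1 p.2) :=
    (LinearEquiv.piCurry R fun i j => K i j).symm.toLinearMap ∘ₗ
      (LinearMap.pi fun i => f i ∘ₗ LinearMap.proj i)
  have hg : Function.Injective g :=
    (LinearEquiv.piCurry R fun i j => K i j).symm.injective.comp (Function.Injective.piMap hf)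
  exact (SubCl.pi_of_fintype (fun p : (i : Fin n) × Fin (m i) => K p.1 p.2)
    fun p => hK p.1 p.2).of_injective (f := g ∘ₗ s)
    (hg.comp (Function.LeftInverse.injective hsr))

/-- `Filt (Fac C)` is closed under quotient modules. -/
lemma FiltCl.of_surjective {M N : ModuleCat.{0} R} (h : FiltCl R (FacCl R C) M)
    {f : M →ₗ[R] N} (hf : Function.Surjective f) : FiltCl R (FacCl R C) N := by
  rw [filtCl_iff_reflTransGen] at h ⊢
  have := h.lift (p := FiltStep (FacCl R C)) (Submodule.map f) fun A B hAB =>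
    ⟨Submodule.map_mono hAB.1, addCl_facCl_iff.2 <| (addCl_facCl_iff.1 hAB.2).of_surjective <|
      subquotientMap_surjective f (Submodule.le_comap_map f A) (Submodule.le_comap_map f B)
        le_rfl⟩
  simpa [Function.onFun, Submodule.map_top, LinearMap.range_eq_top.2 hf] using this

/-- `Filt (Sub C)` is closed under submodules. -/
lemma FiltCl.of_injective {M N : ModuleCat.{0} R} (h : FiltCl R (SubCl R C) N)
    {f : M →ₗ[R] N} (hf : Function.Injective f) : FiltCl R (SubCl R C) M := by
  rw [filtCl_iff_reflTransGen] at h ⊢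
  have := h.lift (p := FiltStep (SubCl R C)) (Submodule.comap f) fun A B hAB =>
    ⟨Submodule.comap_mono hAB.1, addCl_subCl_iff.2 <| (addCl_subCl_iff.1 hAB.2).of_injective <|
      subquotientMap_injective f le_rfl le_rfl inf_le_right⟩
  simpa [Function.onFun, LinearMap.ker_eq_bot.2 hf] using this

lemma FacCl.finite (hC : ∀ M, C M → Module.Finite R M) {M : ModuleCat.{0} R}
    (h : FacCl R C M) : Module.Finite R M := by
  obtain ⟨n, N, hN, f, hf⟩ := h
  have := fun i => hC _ (hN i)
  exact Module.Finite.of_surjective f hf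

lemma SubCl.finite [IsNoetherianRing R] (hC : ∀ M, C M → Module.Finite R M)
    {M : ModuleCat.{0} R} (h : SubCl R C M) : Module.Finite R M := by
  obtain ⟨n, N, hN, f, hf⟩ := h
  have := fun i => hC _ (hN i)
  exact Module.Finite.of_injective f hf

end FacSub

/-- For a finite-dimensional algebra `Λ` over a field `k` and any class
`C` of finitely generated `Λ`-modules, `Filt(Fac C)` is a torsion class and
`Filt(Sub C)` is a torsion-free class in the category of finitely generated `Λ`-modules. -/
theorem statement_0 (k Λ : Type) [Field k] [Ring Λ] [Algebra k Λ]
    [FiniteDimensional k Λ] (C : ModuleCat.{0} Λ → Prop)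
    (hC : ∀ M, C M → Module.Finite Λ M) :
    IsTorsionClassIn Λ (FGMod Λ) (FiltCl Λ (FacCl Λ C)) ∧
    IsTorsionFreeClassIn Λ (FGMod Λ) (FiltCl Λ (SubCl Λ C)) := by
  have : IsNoetherianRing Λ := isNoetherian_of_tower k inferInstance
  exact ⟨⟨fun _ h => h.finite fun _ hX => (addCl_facCl_iff.1 hX).finite hC,
      fun _ _ _ _ hf h => h.of_surjective hf, fun n N h _ => FiltCl.pi n N h,
      fun _ A _ hA hQ => .of_extension A hA hQ⟩,
    ⟨fun _ h => h.finite fun _ hX => (addCl_subCl_iff.1 hX).finite hC,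
      fun _ _ _ _ hf h => h.of_injective hf, fun n N h _ => FiltCl.pi n N h,
      fun _ A _ hA hQ => .of_extension A hA hQ⟩⟩

end Paper
end

section
/- Let k be a field, G̃ a finite group, G a normal subgroup of G̃, U a finitely generated kG-module, and Ũ a kG̃-module extending U. Then, in the category of finitely generated kG̃-modules, T(Ind_G^{G̃} U) = T(⊕_V (Ũ ⊗ V)) and F(Ind_G^{G̃} U) = F(⊕_V (Ũ ⊗ V)), where V runs through a set of representatives of the isomorphism classes of simple k[G̃/G]-modules regarded as kG̃-modules. -/
open scoped TensorProduct

namespace Paper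

section ClosureProperties

variable {R : Type} [Ring R] {T : ModuleCat.{0} R → Prop}

theorem IsTorsionClassIn.of_equiv (hT : IsTorsionClassIn R (FGMod R) T)
    {M N : Type} [AddCommGroup M] [Module R M] [AddCommGroup N] [Module R N]
    (e : M ≃ₗ[R] N) (h : T (ModuleCat.of R M)) : T (ModuleCat.of R N) :=
  have : Module.Finite R M := hT.1 _ h
  hT.2.1 (.of R M) (.of R N) e.toLinearMap (Module.Finite.equiv e) e.surjective h

theorem IsTorsionFreeClassIn.of_equiv (hT : IsTorsionFreeClassIn R (FGMod R) T)
    {M N : Type} [AddCommGroup M] [Module R M] [AddCommGroup N] [Module R N]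
    (e : M ≃ₗ[R] N) (h : T (ModuleCat.of R M)) : T (ModuleCat.of R N) :=
  have : Module.Finite R M := hT.1 _ h
  hT.2.1 (.of R N) (.of R M) e.symm.toLinearMap (Module.Finite.equiv e) e.symm.injective h

theorem IsTorsionClassIn.pi (hT : IsTorsionClassIn R (FGMod R) T) {n : ℕ} {N : Fin n → Type}
    [∀ i, AddCommGroup (N i)] [∀ i, Module R (N i)] (h : ∀ i, T (ModuleCat.of R (N i))) :
    T (ModuleCat.of R ((i : Fin n) → N i)) :=
  have : ∀ i, Module.Finite R (N i) := fun i => hT.1 _ (h i)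
  hT.2.2.1 n (fun i => .of R (N i)) h (inferInstanceAs (Module.Finite R ((i : Fin n) → N i)))

theorem IsTorsionFreeClassIn.pi (hT : IsTorsionFreeClassIn R (FGMod R) T) {n : ℕ}
    {N : Fin n → Type} [∀ i, AddCommGroup (N i)] [∀ i, Module R (N i)]
    (h : ∀ i, T (ModuleCat.of R (N i))) :
    T (ModuleCat.of R ((i : Fin n) → N i)) :=
  have : ∀ i, Module.Finite R (N i) := fun i => hT.1 _ (h i)
  hT.2.2.1 n (fun i => .of R (N i)) h (inferInstanceAs (Module.Finite R ((i : Fin n) → N i)))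

theorem IsTorsionClassIn.of_subsingleton (hT : IsTorsionClassIn R (FGMod R) T)
    (M : Type) [AddCommGroup M] [Module R M] [Subsingleton M] : T (ModuleCat.of R M) :=
  hT.of_equiv (0 : ((i : Fin 0) → (fun _ => PUnit : Fin 0 → Type) i) ≃ₗ[R] M)
    (hT.pi fun i => i.elim0)

theorem IsTorsionFreeClassIn.of_subsingleton (hT : IsTorsionFreeClassIn R (FGMod R) T)
    (M : Type) [AddCommGroup M] [Module R M] [Subsingleton M] : T (ModuleCat.of R M) :=
  hT.of_equiv (0 : ((i : Fin 0) → (fun _ => PUnit : Fin 0 → Type) i) ≃ₗ[R] M)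
    (hT.pi fun i => i.elim0)

/-- Closure under extensions, phrased with a short exact sequence. -/
theorem mem_of_exact
    (hiso : ∀ {M N : Type} [AddCommGroup M] [Module R M] [AddCommGroup N] [Module R N],
      (M ≃ₗ[R] N) → T (ModuleCat.of R M) → T (ModuleCat.of R N))
    (hextn : ∀ (M : ModuleCat.{0} R) (A : Submodule R M), FGMod R M →
      T (ModuleCat.of R ↥A) → T (ModuleCat.of R (↥M ⧸ A)) → T M)
    {A B C : Type} [AddCommGroup A] [Module R A] [AddCommGroup B] [Module R B]
    [AddCommGroup C] [Module R C] [Module.Finite R B] {f : A →ₗ[R] B} {g : B →ₗ[R] C}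
    (hf : Function.Injective f) (hg : Function.Surjective g) (hfg : Function.Exact f g)
    (hA : T (ModuleCat.of R A)) (hC : T (ModuleCat.of R C)) : T (ModuleCat.of R B) := by
  refine hextn (.of R B) (LinearMap.ker g) ‹_› (hiso ?_ hA) (hiso ?_ hC)
  · exact (LinearEquiv.ofInjective f hf).trans
      (LinearEquiv.ofEq _ _ (LinearMap.exact_iff.mp hfg).symm)
  · exact (g.quotKerEquivOfSurjective hg).symm

end ClosureProperties

section DiagonalTensor

variable (k : Type) [Field k] (Gt : Type) [Group Gt] (G : Subgroup Gt) [G.Normal]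

/-- `V ⊗ₖ N` with the diagonal `G̃`-action, for a `k[G̃]`-module `V` and a `k[G̃/G]`-module `N`. -/
abbrev DiagTensor (V : Type) [AddCommGroup V] [Module k V] [Module (MonoidAlgebra k Gt) V]
    [IsScalarTower k (MonoidAlgebra k Gt) V]
    (N : Type) [AddCommGroup N] [Module k N] [Module (MonoidAlgebra k (Gt ⧸ G)) N]
    [IsScalarTower k (MonoidAlgebra k (Gt ⧸ G)) N] : Type :=
  ((Representation.ofModule' (k := k) (G := Gt) V).tprod
    ((Representation.ofModule' (k := k) (G := Gt ⧸ G) N).comp (QuotientGroup.mk' G))).asModule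

variable {k Gt}
variable {V : Type} [AddCommGroup V] [Module k V] [Module (MonoidAlgebra k Gt) V]
  [IsScalarTower k (MonoidAlgebra k Gt) V]

section

variable {N : Type} [AddCommGroup N] [Module k N] [Module (MonoidAlgebra k (Gt ⧸ G)) N]
  [IsScalarTower k (MonoidAlgebra k (Gt ⧸ G)) N]

variable (k V N) in
/-- The underlying `k`-linear identification of `DiagTensor` with the tensor product. -/
noncomputable def diagEquiv : DiagTensor k Gt G V N ≃ₗ[k] V ⊗[k] N :=
  Representation.asModuleEquiv _

variable (k) in
/-- A pure tensor, as an element of `DiagTensor`. -/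
noncomputable def dtmul (v : V) (n : N) : DiagTensor k Gt G V N :=
  (diagEquiv k G V N).symm (v ⊗ₜ[k] n)

theorem of_smul_dtmul (x : Gt) (v : V) (n : N) :
    MonoidAlgebra.of k Gt x • dtmul k G v n =
      dtmul k G (MonoidAlgebra.of k Gt x • v)
        (MonoidAlgebra.of k (Gt ⧸ G) (QuotientGroup.mk x) • n) := by
  rw [dtmul, diagEquiv, ← Representation.asModuleEquiv_symm_map_rho]
  rfl

instance [Module.Finite k V] [Module.Finite k N] [Finite Gt] :
    Module.Finite (MonoidAlgebra k Gt) (DiagTensor k Gt G V N) :=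
  Module.Finite.of_restrictScalars_finite k _ _

/-- The `k[G̃]`-linear map out of `V ⊗ₖ N` given by an equivariant `k`-linear map. -/
noncomputable def diagLift {M : Type} [AddCommGroup M] [Module k M] [Module (MonoidAlgebra k Gt) M]
    [IsScalarTower k (MonoidAlgebra k Gt) M] (f : V ⊗[k] N →ₗ[k] M)
    (hf : ∀ (x : Gt) (v : V) (n : N),
      f ((MonoidAlgebra.of k Gt x • v) ⊗ₜ
        (MonoidAlgebra.of k (Gt ⧸ G) (QuotientGroup.mk x) • n)) =
        MonoidAlgebra.of k Gt x • f (v ⊗ₜ n)) :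
    DiagTensor k Gt G V N →ₗ[MonoidAlgebra k Gt] M :=
  MonoidAlgebra.equivariantOfLinearOfComm
    (f ∘ₗ (diagEquiv k G V N).toLinearMap) fun x t => by
      obtain ⟨t, rfl⟩ := (diagEquiv k G V N).symm.surjective t
      induction t with
      | zero => simp
      | add a b ha hb => simp only [map_add, smul_add, ha, hb]
      | tmul v n =>
        have h := of_smul_dtmul (k := k) G x v n
        rw [MonoidAlgebra.of_apply] at h
        change f (diagEquiv k G V N (MonoidAlgebra.single x (1 : k) • dtmul k G v n)) = _
        rw [h]
        exact hf x v n

theorem diagLift_dtmul {M : Type} [AddCommGroup M] [Module k M] [Module (MonoidAlgebra k Gt) M]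
    [IsScalarTower k (MonoidAlgebra k Gt) M] (f : V ⊗[k] N →ₗ[k] M) (hf) (v : V) (n : N) :
    diagLift G f hf (dtmul k G v n) = f (v ⊗ₜ n) := rfl

theorem DiagTensorIso.nonempty_equiv {M : Type} [AddCommGroup M] [Module k M]
    [Module (MonoidAlgebra k Gt) M] [IsScalarTower k (MonoidAlgebra k Gt) M]
    (h : DiagTensorIso k Gt G V N M) :
    Nonempty (DiagTensor k Gt G V N ≃ₗ[MonoidAlgebra k Gt] M) := by
  obtain ⟨θ, hθ⟩ := h
  exact ⟨LinearEquiv.ofBijective (diagLift G θ.toLinearMap hθ)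
    (θ.bijective.comp (diagEquiv k G V N).bijective)⟩

end

section Functoriality

variable {N N' N'' : Type} [AddCommGroup N] [Module k N] [Module (MonoidAlgebra k (Gt ⧸ G)) N]
  [IsScalarTower k (MonoidAlgebra k (Gt ⧸ G)) N]
  [AddCommGroup N'] [Module k N'] [Module (MonoidAlgebra k (Gt ⧸ G)) N']
  [IsScalarTower k (MonoidAlgebra k (Gt ⧸ G)) N']
  [AddCommGroup N''] [Module k N''] [Module (MonoidAlgebra k (Gt ⧸ G)) N'']
  [IsScalarTower k (MonoidAlgebra k (Gt ⧸ G)) N'']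

variable (V) in
/-- Functoriality of `V ⊗ₖ N` in `N`. -/
noncomputable def diagMap (f : N →ₗ[MonoidAlgebra k (Gt ⧸ G)] N') :
    DiagTensor k Gt G V N →ₗ[MonoidAlgebra k Gt] DiagTensor k Gt G V N' :=
  diagLift G ((diagEquiv k G V N').symm.toLinearMap ∘ₗ
    (f.restrictScalars k).lTensor V) fun x v n => by
      simp only [LinearMap.comp_apply, LinearMap.lTensor_tmul, LinearMap.restrictScalars_apply,
        map_smul]
      exact (of_smul_dtmul G x v (f n)).symm

theorem diagMap_surjective {f : N →ₗ[MonoidAlgebra k (Gt ⧸ G)] N'} (hf : Function.Surjective f) :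
    Function.Surjective (diagMap G V f) :=
  (diagEquiv k G V N').symm.surjective.comp
    ((LinearMap.lTensor_surjective V (g := f.restrictScalars k) hf).comp
      (diagEquiv k G V N).surjective)

theorem diagMap_injective {f : N →ₗ[MonoidAlgebra k (Gt ⧸ G)] N'} (hf : Function.Injective f) :
    Function.Injective (diagMap G V f) :=
  (diagEquiv k G V N').symm.injective.comp
    ((Module.Flat.lTensor_preserves_injective_linearMap (M := V) (f.restrictScalars k) hf).comp
      (diagEquiv k G V N).injective)

theorem diagMap_exact {f : N →ₗ[MonoidAlgebra k (Gt ⧸ G)] N'}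
    {g : N' →ₗ[MonoidAlgebra k (Gt ⧸ G)] N''} (hfg : Function.Exact f g)
    (hg : Function.Surjective g) : Function.Exact (diagMap G V f) (diagMap G V g) :=
  lTensor_exact V (f := f.restrictScalars k) (g := g.restrictScalars k) hfg hg

theorem diagTensor_equiv (e : N ≃ₗ[MonoidAlgebra k (Gt ⧸ G)] N') :
    Nonempty (DiagTensor k Gt G V N ≃ₗ[MonoidAlgebra k Gt] DiagTensor k Gt G V N') :=
  ⟨LinearEquiv.ofBijective (diagMap G V e.toLinearMap)
    ⟨diagMap_injective G e.injective, diagMap_surjective G e.surjective⟩⟩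

end Functoriality

/-- A class of modules closed under extensions which contains `V ⊗ S` for all simple `S`
contains `V ⊗ N` for all `N` of finite length. -/
theorem diagTensor_mem_of_isFiniteLength [Finite Gt] [Module.Finite k V]
    {T : ModuleCat.{0} (MonoidAlgebra k Gt) → Prop}
    (hzero : ∀ (M : Type) [AddCommGroup M] [Module (MonoidAlgebra k Gt) M] [Subsingleton M],
      T (ModuleCat.of _ M))
    (hiso : ∀ {M N : Type} [AddCommGroup M] [Module (MonoidAlgebra k Gt) M]
      [AddCommGroup N] [Module (MonoidAlgebra k Gt) N],
      (M ≃ₗ[MonoidAlgebra k Gt] N) → T (ModuleCat.of _ M) → T (ModuleCat.of _ N))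
    (hextn : ∀ (M : ModuleCat.{0} (MonoidAlgebra k Gt)) (A : Submodule (MonoidAlgebra k Gt) M),
      FGMod _ M → T (ModuleCat.of _ ↥A) → T (ModuleCat.of _ (↥M ⧸ A)) → T M)
    (hsimple : ∀ S : BModule k (MonoidAlgebra k (Gt ⧸ G)),
      IsSimpleModule (MonoidAlgebra k (Gt ⧸ G)) ↥S →
      T (ModuleCat.of _ (DiagTensor k Gt G V ↥S)))
    {N : Type} [AddCommGroup N] [Module (MonoidAlgebra k (Gt ⧸ G)) N]
    (hN : IsFiniteLength (MonoidAlgebra k (Gt ⧸ G)) N) :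
    ∀ [Module k N] [IsScalarTower k (MonoidAlgebra k (Gt ⧸ G)) N],
    T (ModuleCat.of _ (DiagTensor k Gt G V N)) := by
  induction hN with
  | of_subsingleton =>
    rename_i M _ _ _
    intro _ _
    have : Subsingleton (DiagTensor k Gt G V M) :=
      (diagEquiv k G V M).toEquiv.subsingleton
    exact hzero _
  | of_simple_quotient hA ih =>
    rename_i M _ _ A _
    intro _ _
    have hM : IsFiniteLength (MonoidAlgebra k (Gt ⧸ G)) M := .of_simple_quotient hA
    have := (isFiniteLength_iff_isNoetherian_isArtinian.mp hM).1
    have : Module.Finite k M := Module.Finite.trans (MonoidAlgebra k (Gt ⧸ G)) M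
    have hS := hsimple ⟨M ⧸ A⟩ ‹_›
    exact mem_of_exact hiso hextn (diagMap_injective G A.injective_subtype)
      (diagMap_surjective G A.mkQ_surjective)
      (diagMap_exact G (LinearMap.exact_subtype_mkQ A) A.mkQ_surjective) ih hS

end DiagonalTensor

section Simple

variable (k : Type) [Field k] (Q : Type) [Group Q]

theorem exists_surjective_of_isSimpleModule (S : Type) [AddCommGroup S]
    [Module (MonoidAlgebra k Q) S] [IsSimpleModule (MonoidAlgebra k Q) S] :
    ∃ f : MonoidAlgebra k Q →ₗ[MonoidAlgebra k Q] S, Function.Surjective f := by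
  have := IsSimpleModule.nontrivial (MonoidAlgebra k Q) S
  obtain ⟨s, hs⟩ := exists_ne (0 : S)
  exact ⟨_, IsSimpleModule.toSpanSingleton_surjective (MonoidAlgebra k Q) hs⟩

/-- A simple module over a finite group algebra embeds into the regular module, via
`s ↦ ∑ q, φ (q⁻¹ s) q` for a nonzero linear functional `φ`. -/
theorem exists_injective_of_isSimpleModule [Finite Q] (S : Type) [AddCommGroup S] [Module k S]
    [Module (MonoidAlgebra k Q) S] [IsScalarTower k (MonoidAlgebra k Q) S]
    [IsSimpleModule (MonoidAlgebra k Q) S] :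
    ∃ f : S →ₗ[MonoidAlgebra k Q] MonoidAlgebra k Q, Function.Injective f := by
  have := IsSimpleModule.nontrivial (MonoidAlgebra k Q) S
  obtain ⟨s, hs⟩ := exists_ne (0 : S)
  obtain ⟨φ, hφ⟩ := Module.Projective.exists_dual_ne_zero k hs
  let f : S →ₗ[k] MonoidAlgebra k Q :=
    (MonoidAlgebra.coeffLinearEquiv k).symm.toLinearMap ∘ₗ
      (Finsupp.linearEquivFunOnFinite k k Q).symm.toLinearMap ∘ₗ
        LinearMap.pi fun q => φ ∘ₗ MonoidAlgebra.GroupSMul.linearMap k S q⁻¹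
  have hf (t : S) (q : Q) : (f t).coeff q = φ (MonoidAlgebra.single q⁻¹ (1 : k) • t) := rfl
  refine ⟨MonoidAlgebra.equivariantOfLinearOfComm f fun g t => ?_,
    LinearMap.injective_of_ne_zero fun h => hφ ?_⟩
  · ext q
    obtain ⟨q, rfl⟩ : ∃ q', q = g * q' := ⟨g⁻¹ * q, by simp⟩
    rw [smul_eq_mul, MonoidAlgebra.coeff_single_mul_mul, hf, hf, smul_smul,
      MonoidAlgebra.single_mul_single]
    simp
  · have h1 : (f s).coeff 1 = 0 := by
      rw [show f s = 0 from DFunLike.congr_fun h s]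
      rfl
    rwa [hf, inv_one, ← MonoidAlgebra.one_def, one_smul] at h1

end Simple

section Induction

variable {k : Type} [Field k] {Gt : Type} [Group Gt] (G : Subgroup Gt)
variable {U : Type} [AddCommGroup U] [Module (MonoidAlgebra k ↥G) U]
variable {V : Type} [AddCommGroup V] [Module k V] [Module (MonoidAlgebra k Gt) V]
  [IsScalarTower k (MonoidAlgebra k Gt) V]

theorem MapAlong_algebraMap {A B : Type} [Group A] [Group B] (f : A →* B) (c : k) :
    MapAlong k f (algebraMap k _ c) = algebraMap k _ c :=
  DFunLike.congr_fun (MonoidAlgebra.mapDomainRingHom_comp_algebraMap (R := k) (A := k) f) c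

theorem MapAlong_single {A B : Type} [Group A] [Group B] (f : A →* B) (a : A) (c : k) :
    MapAlong k f (MonoidAlgebra.single a c) = c • MonoidAlgebra.of k B (f a) := by
  simp [MapAlong]

theorem ExtendsAlong.finite [Finite Gt] [Module.Finite (MonoidAlgebra k ↥G) U]
    (h : ExtendsAlong k G.subtype U V) : Module.Finite k V := by
  obtain ⟨φ, hφ⟩ := h
  let := Module.compHom V (MapAlong k G.subtype)
  have : IsScalarTower k (MonoidAlgebra k ↥G) V := .of_algebraMap_smul fun c v => by
    change MapAlong k G.subtype (algebraMap k _ c) • v = c • v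
    rw [MapAlong_algebraMap, algebraMap_smul]
  have : Module.Finite (MonoidAlgebra k ↥G) V :=
    .equiv ({ φ with map_smul' := hφ } : U ≃ₗ[MonoidAlgebra k ↥G] V)
  exact .trans (MonoidAlgebra k ↥G) V

variable [G.Normal] {W : Type} [AddCommGroup W] [Module (MonoidAlgebra k Gt) W]

theorem of_smul_of_inv_smul {M : Type} [AddCommGroup M] [Module (MonoidAlgebra k Gt) M]
    (x : Gt) (v : M) :
    MonoidAlgebra.of k Gt x • MonoidAlgebra.of k Gt x⁻¹ • v = v := by
  rw [smul_smul, ← map_mul, mul_inv_cancel, map_one, one_smul]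

theorem of_mk_coe_eq_one (g : ↥G) :
    MonoidAlgebra.of k (Gt ⧸ G) (QuotientGroup.mk (g : Gt)) = 1 := by
  rw [(QuotientGroup.eq_one_iff (g : Gt)).mpr g.2, map_one]

theorem MapAlong_smul_dtmul_one (a : MonoidAlgebra k ↥G) (v : V) :
    MapAlong k G.subtype a • (dtmul k G v 1 : DiagTensor k Gt G V (MonoidAlgebra k (Gt ⧸ G))) =
      dtmul k G (MapAlong k G.subtype a • v) 1 := by
  induction a using MonoidAlgebra.induction_linear with
  | zero => simp [dtmul]
  | add a b ha hb =>
    simp only [map_add, add_smul, ha, hb]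
    simp only [dtmul, TensorProduct.add_tmul, map_add]
  | single g c =>
    rw [MapAlong_single, smul_assoc, smul_assoc, G.subtype_apply, of_smul_dtmul, of_mk_coe_eq_one,
      one_smul]
    exact ((diagEquiv k G V _).symm.map_smul c (_ ⊗ₜ 1)).symm

/-- A `k[G]`-linear map `V → W` extends to the `k[G̃]`-linear map
`V ⊗ k[G̃/G] → W`, `v ⊗ xG ↦ x η (x⁻¹ v)`. -/
theorem exists_diagTensor_lift [Module k W] [IsScalarTower k (MonoidAlgebra k Gt) W]
    (η : V →+ W) (hη : ∀ (a : MonoidAlgebra k ↥G) (v : V),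
      η (MapAlong k G.subtype a • v) = MapAlong k G.subtype a • η v) :
    ∃ F : DiagTensor k Gt G V (MonoidAlgebra k (Gt ⧸ G)) →ₗ[MonoidAlgebra k Gt] W,
      ∀ v, F (dtmul k G v 1) = η v := by
  let η' : V →ₗ[k] W := { η with
    map_smul' := fun c v => by
      have := hη (algebraMap k _ c) v
      rw [MapAlong_algebraMap, algebraMap_smul, algebraMap_smul] at this
      exact this }
  let L (x : Gt) : V →ₗ[k] W :=
    MonoidAlgebra.GroupSMul.linearMap k W x ∘ₗ η' ∘ₗ MonoidAlgebra.GroupSMul.linearMap k V x⁻¹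
  have hL (x : Gt) (v : V) :
      L x v = MonoidAlgebra.of k Gt x • η (MonoidAlgebra.of k Gt x⁻¹ • v) := rfl
  have hLG (x : Gt) (g : ↥G) : L (x * g) = L x := by
    ext v
    have := hη (MonoidAlgebra.single g⁻¹ 1) (MonoidAlgebra.of k Gt x⁻¹ • v)
    rw [MapAlong_single, one_smul, smul_smul, ← map_mul] at this
    rw [hL, hL, mul_inv_rev, map_mul, mul_smul]
    simp only [G.subtype_apply, InvMemClass.coe_inv] at this
    rw [this, of_smul_of_inv_smul]
  have hout (x : Gt) : L (Quotient.out (QuotientGroup.mk x : Gt ⧸ G)) = L x := by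
    obtain ⟨g, hg⟩ := QuotientGroup.mk_out_eq_mul G x
    rw [hg, hLG]
  let B : MonoidAlgebra k (Gt ⧸ G) →ₗ[k] V →ₗ[k] W :=
    Finsupp.linearCombination k (fun q : Gt ⧸ G => L q.out) ∘ₗ
      (MonoidAlgebra.coeffLinearEquiv k).toLinearMap
  have hB (x : Gt) (c : k) : B (MonoidAlgebra.single (QuotientGroup.mk x) c) = c • L x := by
    rw [← hout]
    exact Finsupp.linearCombination_single k c _
  refine ⟨diagLift G (TensorProduct.lift B.flip) fun x v n => ?_, fun v => ?_⟩
  · simp only [TensorProduct.lift.tmul, LinearMap.flip_apply]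
    induction n using MonoidAlgebra.induction_linear with
    | zero => simp
    | add a b ha hb => simp only [smul_add, map_add, LinearMap.add_apply, ha, hb]
    | single q c =>
      obtain ⟨y, rfl⟩ := QuotientGroup.mk_surjective q
      rw [smul_eq_mul, MonoidAlgebra.of_apply,
        MonoidAlgebra.single_mul_single, one_mul, ← QuotientGroup.mk_mul, hB, hB,
        LinearMap.smul_apply, LinearMap.smul_apply, smul_comm, hL, hL, smul_smul, smul_smul,
        ← map_mul, ← map_mul]
      simp
  · rw [diagLift_dtmul, TensorProduct.lift.tmul, LinearMap.flip_apply, MonoidAlgebra.one_def,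
      ← QuotientGroup.mk_one, hB, one_smul, hL, inv_one, map_one,
      one_smul, one_smul]

/-- `Ind_G^{G̃} U ≅ Ũ ⊗ k[G̃/G]` when `Ũ` extends `U`. -/
theorem IsInducedAlong.nonempty_equiv_diagTensor (hext : ExtendsAlong k G.subtype U V)
    (hW : IsInducedAlong k G.subtype U W) :
    Nonempty (W ≃ₗ[MonoidAlgebra k Gt] DiagTensor k Gt G V (MonoidAlgebra k (Gt ⧸ G))) := by
  obtain ⟨φ, hφ⟩ := hext
  obtain ⟨η, hη, huniv⟩ := hW
  let : Module k W := Module.compHom W (algebraMap k (MonoidAlgebra k Gt))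
  have : IsScalarTower k (MonoidAlgebra k Gt) W := .of_algebraMap_smul fun _ _ => rfl
  let γ : V →+ DiagTensor k Gt G V (MonoidAlgebra k (Gt ⧸ G)) :=
    (diagEquiv k G V _).symm.toLinearMap.toAddMonoidHom.comp
      ((TensorProduct.mk k V _).flip 1).toAddMonoidHom
  have hγ (v : V) : γ v = dtmul k G v 1 := rfl
  obtain ⟨F, hF, -⟩ := huniv ⟨DiagTensor k Gt G V (MonoidAlgebra k (Gt ⧸ G))⟩
    (γ.comp φ.toAddMonoidHom) fun a u => by
      change γ (φ (a • u)) = MapAlong k G.subtype a • γ (φ u)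
      rw [hφ, hγ, hγ, MapAlong_smul_dtmul_one]
  replace hF (u : U) : F (η u) = dtmul k G (φ u) 1 := hF u
  obtain ⟨E, hE⟩ := exists_diagTensor_lift G (k := k) (η.comp φ.symm.toAddMonoidHom)
      fun a v => by
    change η (φ.symm _) = MapAlong k G.subtype a • η (φ.symm v)
    rw [← hη]
    congr 1
    rw [φ.symm_apply_eq, hφ, φ.apply_symm_apply]
  replace hE (v : V) : E (dtmul k G v 1) = η (φ.symm v) := hE v
  have hEF : E ∘ₗ F = LinearMap.id :=
    (huniv ⟨W⟩ η hη).unique (fun u => by simp [hF, hE]) fun u => rfl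
  have hFE (t) : F (E t) = t := by
    obtain ⟨t, rfl⟩ := (diagEquiv k G V _).symm.surjective t
    induction t with
    | zero => simp
    | add a b ha hb => simp only [map_add, ha, hb]
    | tmul v n =>
      induction n using MonoidAlgebra.induction_linear with
      | zero => simp
      | add a b ha hb => simp only [TensorProduct.tmul_add, map_add, ha, hb]
      | single q c =>
        obtain ⟨x, rfl⟩ := QuotientGroup.mk_surjective q
        have key : (diagEquiv k G V _).symm (v ⊗ₜ MonoidAlgebra.single (QuotientGroup.mk x) c) =
            MonoidAlgebra.of k Gt x • (dtmul k G (MonoidAlgebra.of k Gt x⁻¹ • c • v) 1 :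
              DiagTensor k Gt G V (MonoidAlgebra k (Gt ⧸ G))) := by
          rw [of_smul_dtmul, of_smul_of_inv_smul, dtmul, TensorProduct.smul_tmul, smul_eq_mul,
            mul_one, MonoidAlgebra.smul_of]
        rw [key, map_smul, map_smul, hE, hF, φ.apply_symm_apply]
  exact ⟨LinearEquiv.ofLinearMap F E (LinearMap.ext hFE) hEF⟩

end Induction

section TensorSimple

variable {k : Type} [Field k] {Gt : Type} [Group Gt] [Finite Gt] (G : Subgroup Gt) [G.Normal]
variable (V : Type) [AddCommGroup V] [Module k V] [Module (MonoidAlgebra k Gt) V]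
  [IsScalarTower k (MonoidAlgebra k Gt) V] [Module.Finite k V]
variable {n : ℕ} (S : Fin n → BModule k (MonoidAlgebra k (Gt ⧸ G)))
  {M : Fin n → Type} [∀ j, AddCommGroup (M j)] [∀ j, Module (MonoidAlgebra k Gt) (M j)]

theorem finite_of_isSimpleModule (N : Type) [AddCommGroup N] [Module k N]
    [Module (MonoidAlgebra k (Gt ⧸ G)) N] [IsScalarTower k (MonoidAlgebra k (Gt ⧸ G)) N]
    [IsSimpleModule (MonoidAlgebra k (Gt ⧸ G)) N] : Module.Finite k N :=
  .trans (MonoidAlgebra k (Gt ⧸ G)) N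

theorem isFiniteLength_monoidAlgebra (Q : Type) [Group Q] [Finite Q] :
    IsFiniteLength (MonoidAlgebra k Q) (MonoidAlgebra k Q) :=
  isFiniteLength_iff_isNoetherian_isArtinian.mpr
    ⟨isNoetherian_of_tower k inferInstance, isArtinian_of_tower k inferInstance⟩

/-- A torsion class contains `V ⊗ k[G̃/G]` if and only if it contains the sum of all `V ⊗ S`,
`S` simple. -/
theorem IsTorsionClassIn.diagTensor_iff_pi {T : ModuleCat.{0} (MonoidAlgebra k Gt) → Prop}
    (hT : IsTorsionClassIn _ (FGMod _) T)
    (hS : ∀ j, IsSimpleModule (MonoidAlgebra k (Gt ⧸ G)) ↥(S j))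
    (hcompl : ∀ N : BModule k (MonoidAlgebra k (Gt ⧸ G)),
      IsSimpleModule (MonoidAlgebra k (Gt ⧸ G)) ↥N →
      ∃ j, Nonempty (↥N ≃ₗ[MonoidAlgebra k (Gt ⧸ G)] ↥(S j)))
    (eM : ∀ j, DiagTensor k Gt G V ↥(S j) ≃ₗ[MonoidAlgebra k Gt] M j) :
    T (ModuleCat.of _ (DiagTensor k Gt G V (MonoidAlgebra k (Gt ⧸ G)))) ↔
      T (ModuleCat.of _ ((j : Fin n) → M j)) := by
  have (j : Fin n) : Module.Finite k ↥(S j) := finite_of_isSimpleModule G _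
  have (j : Fin n) : Module.Finite (MonoidAlgebra k Gt) (M j) := .equiv (eM j)
  constructor
  · refine fun h => hT.pi fun j => hT.of_equiv (eM j) ?_
    obtain ⟨f, hf⟩ := exists_surjective_of_isSimpleModule k (Gt ⧸ G) ↥(S j)
    exact hT.2.1 (.of _ _) (.of _ _) (diagMap G V f)
      (inferInstanceAs (Module.Finite _ (DiagTensor k Gt G V ↥(S j)))) (diagMap_surjective G hf) h
  · refine fun h => diagTensor_mem_of_isFiniteLength G (fun M => hT.of_subsingleton M)
      hT.of_equiv hT.2.2.2 (fun N hN => ?_) (isFiniteLength_monoidAlgebra _)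
    obtain ⟨j, ⟨i⟩⟩ := hcompl N hN
    obtain ⟨i⟩ := diagTensor_equiv G (V := V) i
    exact hT.of_equiv ((eM j).symm.trans i.symm) (hT.2.1 (.of _ _) (.of _ (M j))
      (LinearMap.proj j) (‹∀ j, Module.Finite _ (M j)› j) (LinearMap.proj_surjective j) h)

/-- A torsion-free class contains `V ⊗ k[G̃/G]` if and only if it contains the sum of all `V ⊗ S`,
`S` simple. -/
theorem IsTorsionFreeClassIn.diagTensor_iff_pi {T : ModuleCat.{0} (MonoidAlgebra k Gt) → Prop}
    (hT : IsTorsionFreeClassIn _ (FGMod _) T)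
    (hS : ∀ j, IsSimpleModule (MonoidAlgebra k (Gt ⧸ G)) ↥(S j))
    (hcompl : ∀ N : BModule k (MonoidAlgebra k (Gt ⧸ G)),
      IsSimpleModule (MonoidAlgebra k (Gt ⧸ G)) ↥N →
      ∃ j, Nonempty (↥N ≃ₗ[MonoidAlgebra k (Gt ⧸ G)] ↥(S j)))
    (eM : ∀ j, DiagTensor k Gt G V ↥(S j) ≃ₗ[MonoidAlgebra k Gt] M j) :
    T (ModuleCat.of _ (DiagTensor k Gt G V (MonoidAlgebra k (Gt ⧸ G)))) ↔
      T (ModuleCat.of _ ((j : Fin n) → M j)) := by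
  have (j : Fin n) : Module.Finite k ↥(S j) := finite_of_isSimpleModule G _
  have (j : Fin n) : Module.Finite (MonoidAlgebra k Gt) (M j) := .equiv (eM j)
  constructor
  · refine fun h => hT.pi fun j => hT.of_equiv (eM j) ?_
    obtain ⟨f, hf⟩ := exists_injective_of_isSimpleModule k (Gt ⧸ G) ↥(S j)
    exact hT.2.1 (.of _ _) (.of _ _) (diagMap G V f)
      (inferInstanceAs (Module.Finite _ (DiagTensor k Gt G V ↥(S j)))) (diagMap_injective G hf) h
  · refine fun h => diagTensor_mem_of_isFiniteLength G (fun M => hT.of_subsingleton M)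
      hT.of_equiv hT.2.2.2 (fun N hN => ?_) (isFiniteLength_monoidAlgebra _)
    obtain ⟨j, ⟨i⟩⟩ := hcompl N hN
    obtain ⟨i⟩ := diagTensor_equiv G (V := V) i
    exact hT.of_equiv ((eM j).symm.trans i.symm) (hT.2.1 (.of _ (M j)) (.of _ _)
      (LinearMap.single _ M j) (‹∀ j, Module.Finite _ (M j)› j) (Pi.single_injective j) h)

end TensorSimple

section Generation

variable {R : Type} [Ring R] {M N : Type} [AddCommGroup M] [Module R M]
  [AddCommGroup N] [Module R N]

theorem torsClIn_congr [Module.Finite R M] [Module.Finite R N]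
    (h : ∀ T, IsTorsionClassIn R (FGMod R) T → (T (ModuleCat.of R M) ↔ T (ModuleCat.of R N)))
    (X : ModuleCat.{0} R) :
    TorsClIn R (FGMod R) (fun Y => Nonempty (↥Y ≃ₗ[R] M)) X ↔
      TorsClIn R (FGMod R) (fun Y => Nonempty (↥Y ≃ₗ[R] N)) X :=
  ⟨fun hX T hT hC => hX T hT fun _ _ ⟨i⟩ =>
      hT.of_equiv i.symm ((h T hT).mpr (hC (.of R N) ‹_› ⟨.refl R N⟩)),
    fun hX T hT hC => hX T hT fun _ _ ⟨i⟩ =>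
      hT.of_equiv i.symm ((h T hT).mp (hC (.of R M) ‹_› ⟨.refl R M⟩))⟩

theorem torfClIn_congr [Module.Finite R M] [Module.Finite R N]
    (h : ∀ T, IsTorsionFreeClassIn R (FGMod R) T → (T (ModuleCat.of R M) ↔ T (ModuleCat.of R N)))
    (X : ModuleCat.{0} R) :
    TorfClIn R (FGMod R) (fun Y => Nonempty (↥Y ≃ₗ[R] M)) X ↔
      TorfClIn R (FGMod R) (fun Y => Nonempty (↥Y ≃ₗ[R] N)) X :=
  ⟨fun hX T hT hC => hX T hT fun _ _ ⟨i⟩ =>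
      hT.of_equiv i.symm ((h T hT).mpr (hC (.of R N) ‹_› ⟨.refl R N⟩)),
    fun hX T hT hC => hX T hT fun _ _ ⟨i⟩ =>
      hT.of_equiv i.symm ((h T hT).mp (hC (.of R M) ‹_› ⟨.refl R M⟩))⟩

end Generation

/-- With `Ũ` extending `U`, the smallest torsion class
(resp. torsion-free class) of finitely generated `k[G̃]`-modules containing
`Ind_G^{G̃} U` coincides with the one containing `⊕_V (Ũ ⊗ V)`, `V` running over
representatives of the isomorphism classes of simple `k[G̃/G]`-modules. -/
theorem statement_3 (k : Type) [Field k]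
    (Gt : Type) [Group Gt] [Finite Gt] (G : Subgroup Gt) [G.Normal]
    (U : Type) [AddCommGroup U] [Module (MonoidAlgebra k ↥G) U]
    [Module.Finite (MonoidAlgebra k ↥G) U]
    (Ut : BModule k (MonoidAlgebra k Gt))
    (hext : ExtendsAlong k G.subtype U ↥Ut)
    (e : ℕ) (Vs : Fin e → BModule k (MonoidAlgebra k (Gt ⧸ G)))
    (hsimp : ∀ j, IsSimpleModule (MonoidAlgebra k (Gt ⧸ G)) ↥(Vs j))
    (hdist : ∀ i j, i ≠ j → IsEmpty (↥(Vs i) ≃ₗ[MonoidAlgebra k (Gt ⧸ G)] ↥(Vs j)))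
    (hcompl : ∀ V : BModule k (MonoidAlgebra k (Gt ⧸ G)),
        IsSimpleModule (MonoidAlgebra k (Gt ⧸ G)) ↥V →
        ∃ j, Nonempty (↥V ≃ₗ[MonoidAlgebra k (Gt ⧸ G)] ↥(Vs j)))
    (W : Type) [AddCommGroup W] [Module (MonoidAlgebra k Gt) W]
    (hW : IsInducedAlong k G.subtype U W)
    (Tj : Fin e → BModule k (MonoidAlgebra k Gt))
    (hTj : ∀ j, DiagTensorIso k Gt G ↥Ut ↥(Vs j) ↥(Tj j)) :
    (∀ X : ModuleCat.{0} (MonoidAlgebra k Gt),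
        TorsClIn (MonoidAlgebra k Gt) (FGMod (MonoidAlgebra k Gt))
          (fun Y => Nonempty (↥Y ≃ₗ[MonoidAlgebra k Gt] W)) X ↔
        TorsClIn (MonoidAlgebra k Gt) (FGMod (MonoidAlgebra k Gt))
          (fun Y => Nonempty (↥Y ≃ₗ[MonoidAlgebra k Gt] ((j : Fin e) → ↥(Tj j)))) X) ∧
    (∀ X : ModuleCat.{0} (MonoidAlgebra k Gt),
        TorfClIn (MonoidAlgebra k Gt) (FGMod (MonoidAlgebra k Gt))
          (fun Y => Nonempty (↥Y ≃ₗ[MonoidAlgebra k Gt] W)) X ↔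
        TorfClIn (MonoidAlgebra k Gt) (FGMod (MonoidAlgebra k Gt))
          (fun Y => Nonempty (↥Y ≃ₗ[MonoidAlgebra k Gt] ((j : Fin e) → ↥(Tj j)))) X) := by
  have := hext.finite
  have (j : Fin e) : Module.Finite k ↥(Vs j) := have := hsimp j; finite_of_isSimpleModule G _
  obtain ⟨eW⟩ := hW.nonempty_equiv_diagTensor G hext
  have eT (j : Fin e) := ((hTj j).nonempty_equiv G).some
  have : Module.Finite (MonoidAlgebra k Gt) W := .equiv eW.symm
  have (j : Fin e) : Module.Finite (MonoidAlgebra k Gt) ↥(Tj j) := .equiv (eT j)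
  exact ⟨torsClIn_congr fun T hT => .trans ⟨hT.of_equiv eW, hT.of_equiv eW.symm⟩
      (hT.diagTensor_iff_pi G ↥Ut Vs hsimp hcompl eT),
    torfClIn_congr fun T hT => .trans ⟨hT.of_equiv eW, hT.of_equiv eW.symm⟩
      (hT.diagTensor_iff_pi G ↥Ut Vs hsimp hcompl eT)⟩

end Paper
end

section
/- Let k be an algebraically closed field, G̃ a finite group, G a normal subgroup of G̃, and S a brick in kG-mod which is G̃-stable. Assume the second group cohomology H²(G̃/G, k^×) is trivial. Then there exists a kG̃-module S̃ extending S, i.e., a kG̃-module whose restriction to kG is isomorphic to S. -/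
open scoped TensorProduct

namespace Paper

section GroupExtension

variable {Gt A K : Type*} [Group Gt] [Group A] [CommGroup K] {G : Subgroup Gt} [G.Normal]
  {ρ : G →* A} {Z : K →* A}

/-- Intertwiners between `ρ` and its conjugates can be chosen compatibly on the cosets of `G`. -/
lemma exists_coset_compatible_intertwiners
    (hst : ∀ x : Gt, ∃ t : A, ∀ g : G, t * ρ g = ρ (MulAut.conjNormal x g) * t) :
    ∃ T : Gt → A, (∀ (g : G) (x : Gt), T (g * x) = ρ g * T x) ∧
      ∀ (x : Gt) (g : G), T x * ρ g = ρ (MulAut.conjNormal x g) * T x := by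
  choose ψ hψ using hst
  let s : Gt → Gt := fun x => (QuotientGroup.mk x : Gt ⧸ G).out
  have hs : ∀ (g : G) (x : Gt), s (g * x) = s x := fun g x => by
    have : (QuotientGroup.mk (↑g * x) : Gt ⧸ G) = QuotientGroup.mk x := by
      rw [QuotientGroup.mk_mul, (QuotientGroup.eq_one_iff (g : Gt)).2 g.2, one_mul]
    simp only [s, this]
  have hmem : ∀ x, x * (s x)⁻¹ ∈ G := fun x => by
    rw [← QuotientGroup.eq_one_iff, QuotientGroup.mk_mul, QuotientGroup.mk_inv,
      QuotientGroup.out_eq', mul_inv_cancel]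
  refine ⟨fun x => ρ ⟨x * (s x)⁻¹, hmem x⟩ * ψ (s x), fun g x => ?_, fun x g => ?_⟩
  · have : (⟨g * x * (s (g * x))⁻¹, hmem _⟩ : G) = g * ⟨x * (s x)⁻¹, hmem x⟩ :=
      Subtype.ext (by simp [hs, mul_assoc])
    dsimp only
    rw [this, map_mul, hs, mul_assoc]
  · rw [mul_assoc, hψ, ← mul_assoc, ← mul_assoc, ← map_mul, ← map_mul]
    congr 2
    apply Subtype.ext
    simp [MulAut.conjNormal_apply, mul_assoc]

/-- A homomorphism `ρ` on a normal subgroup `G` which is isomorphic to all its conjugates, and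
whose centralizer is a central subgroup `K` such that every `2`-cocycle of the quotient with
values in `K` is a coboundary, extends to the whole group. -/
theorem exists_monoidHom_extension (hZ : Function.Injective Z)
    (hZc : ∀ c a, Z c * a = a * Z c)
    (hcent : ∀ a : A, (∀ g, a * ρ g = ρ g * a) → ∃ c, a = Z c)
    (hst : ∀ x : Gt, ∃ t : A, ∀ g : G, t * ρ g = ρ (MulAut.conjNormal x g) * t)
    (hH2 : ∀ α : Gt ⧸ G → Gt ⧸ G → K,
      (∀ a b c, α a b * α (a * b) c = α b c * α a (b * c)) →
      ∃ β : Gt ⧸ G → K, ∀ a b, α a b = β a * β b * (β (a * b))⁻¹) :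
    ∃ R : Gt →* A, ∀ g : G, R g = ρ g := by
  obtain ⟨T, hTl, hTc⟩ := exists_coset_compatible_intertwiners hst
  have hex : ∀ x y, ∃ c, T x * T y = Z c * T (x * y) := by
    intro x y
    obtain ⟨c, hc⟩ := hcent (T x * T y * (T (x * y))⁻¹) (fun g => by
      have h : (T (x * y))⁻¹ * ρ g
          = ρ ((MulAut.conjNormal (x * y)).symm g) * (T (x * y))⁻¹ := by
        rw [inv_mul_eq_iff_eq_mul, ← mul_assoc, hTc, MulEquiv.apply_symm_apply,
          mul_inv_cancel_right]
      rw [mul_assoc, h, ← mul_assoc, mul_assoc (T x), hTc y, ← mul_assoc, hTc x,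
        ← MulAut.mul_apply, ← map_mul, MulEquiv.apply_symm_apply, mul_assoc, mul_assoc,
        mul_assoc])
    exact ⟨c, by rw [← hc, inv_mul_cancel_right]⟩
  choose α hα using fun a b : Gt ⧸ G => hex a.out b.out
  have hout : ∀ x : Gt, ∃ g : G, x = g * (QuotientGroup.mk x : Gt ⧸ G).out := fun x =>
    ⟨⟨x * (QuotientGroup.mk x : Gt ⧸ G).out⁻¹, by
      rw [← QuotientGroup.eq_one_iff, QuotientGroup.mk_mul, QuotientGroup.mk_inv,
        QuotientGroup.out_eq', mul_inv_cancel]⟩, by simp⟩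
  have hmul : ∀ x y : Gt, T x * T y = Z (α x y) * T (x * y) := by
    intro x y
    obtain ⟨g, hg⟩ := hout x
    obtain ⟨h, hh⟩ := hout y
    generalize (QuotientGroup.mk x : Gt ⧸ G) = a at *
    generalize (QuotientGroup.mk y : Gt ⧸ G) = b at *
    have hxy : x * y = ↑(g * MulAut.conjNormal a.out h) * (a.out * b.out) := by
      rw [hg, hh]
      simp [MulAut.conjNormal_apply, mul_assoc]
    rw [hxy, hTl, ← mul_assoc, hZc, mul_assoc, ← hα, hg, hh, hTl, hTl, map_mul, mul_assoc,
      ← mul_assoc (T a.out), hTc]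
    simp only [mul_assoc]
  obtain ⟨β, hβ⟩ := hH2 α (fun a b c => by
    induction a using QuotientGroup.induction_on with | _ x
    induction b using QuotientGroup.induction_on with | _ y
    induction c using QuotientGroup.induction_on with | _ z
    apply hZ
    have h := mul_assoc (T x) (T y) (T z)
    rw [hmul, mul_assoc, hmul, hmul y z, ← mul_assoc (T x), ← hZc, mul_assoc (Z _) (T x), hmul x,
      mul_assoc x, ← mul_assoc, ← mul_assoc (Z (α y z)), mul_left_inj, ← map_mul, ← map_mul] at h
    exact h)
  let R : Gt →* A := MonoidHom.mk' (fun x => Z (β x)⁻¹ * T x) fun x y => by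
    have hc : (β ((x * y : Gt) : Gt ⧸ G))⁻¹ = (β x)⁻¹ * (β y)⁻¹ * α x y := by
      rw [hβ, QuotientGroup.mk_mul, mul_comm (β x) (β y)]
      group
    rw [hc, map_mul, map_mul, mul_assoc, ← hmul]
    exact Commute.mul_mul_mul_comm (hZc _ _) _ _
  have h1 : Z (β (1 : Gt))⁻¹ * T 1 = 1 := R.map_one
  refine ⟨R, fun g => ?_⟩
  have hg : ((g : Gt) : Gt ⧸ G) = ((1 : Gt) : Gt ⧸ G) := (QuotientGroup.eq_one_iff (g : Gt)).2 g.2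
  change Z (β (g : Gt))⁻¹ * T g = ρ g
  rw [hg, ← mul_one (g : Gt), hTl, ← mul_assoc, hZc, mul_assoc, h1, mul_one]

end GroupExtension

/-- A module over a group algebra extends along `f` as soon as some representation of the larger
group agrees with it on group elements. -/
lemma exists_extendsAlong_of_representation {k A B : Type} [Field k] [Group A] [Group B]
    (f : A →* B) (S : Type) [AddCommGroup S] [Module k S] [Module (MonoidAlgebra k A) S]
    [IsScalarTower k (MonoidAlgebra k A) S] (σ : Representation k B S)
    (h : ∀ (a : A) (u : S), σ (f a) u = MonoidAlgebra.of k A a • u) :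
    ∃ W : BModule k (MonoidAlgebra k B), ExtendsAlong k f S ↥W := by
  refine ⟨⟨σ.asModule⟩, σ.asModuleEquiv.symm.toAddEquiv, fun a u => ?_⟩
  induction a using MonoidAlgebra.induction_linear with
  | zero => simp
  | add x y hx hy => rw [add_smul, map_add, hx, hy, map_add, add_smul]
  | single g r =>
    have hr : (MonoidAlgebra.single g r : MonoidAlgebra k A) = r • MonoidAlgebra.of k A g := by
      simp
    have hm : MapAlong k f (MonoidAlgebra.single g r) = MonoidAlgebra.single (f g) r :=
      MonoidAlgebra.mapDomain_single
    rw [hm, Representation.single_smul, hr, smul_assoc, ← h]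
    exact map_smul σ.asModuleEquiv.symm r _

/-- A `G̃`-stable brick `S` in `kG`-mod admits an extending
`k[G̃]`-module provided `H²(G̃/G, kˣ)` is trivial. -/
theorem statement_4 (k : Type) [Field k] [IsAlgClosed k]
    (Gt : Type) [Group Gt] [Finite Gt] (G : Subgroup Gt) [G.Normal]
    (S : Type) [AddCommGroup S] [Module (MonoidAlgebra k ↥G) S]
    [Module.Finite (MonoidAlgebra k ↥G) S]
    (hbrick : IsBrickOver k (MonoidAlgebra k ↥G) S)
    (hstable : IsGtStable k Gt G S)
    (hH2 : H2Trivial k (Gt ⧸ G)) :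
    ∃ W : BModule k (MonoidAlgebra k Gt), ExtendsAlong k G.subtype S ↥W := by
  let : Module k S := Module.compHom S (algebraMap k (MonoidAlgebra k G))
  have hsmul : ∀ (c : k) (u : S), c • u = algebraMap k (MonoidAlgebra k G) c • u := fun _ _ => rfl
  have : IsScalarTower k (MonoidAlgebra k G) S :=
    ⟨fun c a u => by rw [hsmul, Algebra.smul_def, mul_smul]⟩
  have := hbrick.1
  let ρ : G →* S ≃ₗ[k] S := (LinearMap.GeneralLinearGroup.generalLinearEquiv k S).toMonoidHom.comp
    (Representation.ofModule' (k := k) (G := G) S).asGroupHom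
  have hρ : ∀ (g : G) (u : S), ρ g u = MonoidAlgebra.of k G g • u := fun _ _ => rfl
  let Z : kˣ →* S ≃ₗ[k] S := DistribMulAction.toModuleAut k S
  obtain ⟨R, hR⟩ := exists_monoidHom_extension (ρ := ρ) (Z := Z)
    (fun c d h => by
      obtain ⟨u, hu⟩ := exists_ne (0 : S)
      refine Units.ext (smul_left_injective k hu ?_)
      exact LinearEquiv.congr_fun h u)
    (fun c a => by
      ext u
      exact (map_smul a (c : k) u).symm)
    (fun a ha => by
      have hlin : ∀ (r : MonoidAlgebra k G) (u : S), a (r • u) = r • a u := fun r u => by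
        induction r using MonoidAlgebra.induction_on with
        | of g => exact LinearEquiv.congr_fun (ha g) u
        | add x y hx hy => rw [add_smul, map_add, hx, hy, add_smul]
        | smul c x hx => rw [smul_assoc, map_smul, hx, smul_assoc]
      obtain ⟨c, hc⟩ := hbrick.2 ⟨a.toLinearMap.toAddHom, hlin⟩
      have hc' : ∀ u, a u = c • u := hc
      have hc0 : c ≠ 0 := by
        rintro rfl
        obtain ⟨u, hu⟩ := exists_ne (0 : S)
        exact hu (a.map_eq_zero_iff.1 (by rw [hc', zero_smul]))
      exact ⟨Units.mk0 c hc0, by ext u; exact hc' u⟩)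
    (fun x => by
      obtain ⟨ψ, hψ⟩ := hstable x
      have hmap : ∀ (g : G) (c : k), MapAlong k (conjHom Gt G x) (MonoidAlgebra.single g c)
          = MonoidAlgebra.single (conjHom Gt G x g) c := fun _ _ => MonoidAlgebra.mapDomain_single
      have hψk : ∀ (c : k) (u : S), ψ (c • u) = c • ψ u := fun c u => by
        have h := hψ (MonoidAlgebra.single 1 c) u
        rwa [hmap, map_one] at h
      refine ⟨ψ.toLinearEquiv hψk, fun g => ?_⟩
      ext u
      have hg : conjHom Gt G x (MulAut.conjNormal x g) = g :=
        Subtype.ext (by simp [conjHom, MulAut.conjNormal_apply, mul_assoc])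
      have h := hψ (MonoidAlgebra.single (MulAut.conjNormal x g) 1) u
      rwa [hmap, hg] at h)
    hH2
  refine exists_extendsAlong_of_representation G.subtype S
    (((LinearMap.GeneralLinearGroup.generalLinearEquiv k S).symm.toMonoidHom.comp R :
      Gt →* LinearMap.GeneralLinearGroup k S) |> (Units.coeHom _).comp) fun g u => ?_
  rw [← hρ, ← hR]
  rfl

end Paper
end

section
/- Let k be an algebraically closed field, G̃ a finite group, G a normal subgroup of G̃, and S a G̃-stable brick in kG-mod, and assume H²(G̃/G, k^×) is trivial. Then for any two kG̃-modules W₁ and W₂ extending S there exists a one-dimensional k[G̃/G]-module V, unique up to isomorphism, such that W₂ ≅ W₁ ⊗ V as kG̃-modules. Consequently, the number of isomorphism classes of kG̃-modules extending S equals the number e of isomorphism classes of one-dimensional k[G̃/G]-modules. -/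
open scoped TensorProduct

namespace Paper

section GroupExtension

/-- A homomorphism `ρ : G → A` all of whose conjugates under `Gt` are conjugate in `A`, and whose
centralizer is a central copy of `kˣ`, extends to `Gt` once `H²(Gt/G, kˣ)` is trivial. -/
theorem exists_extension_of_H2Trivial {k : Type} [Field k] {Gt : Type} [Group Gt]
    {G : Subgroup Gt} [G.Normal] (hH2 : H2Trivial k (Gt ⧸ G)) {A : Type} [Group A]
    (ι : kˣ →* A) (hι : Function.Injective ι) (hcentral : ∀ c a, ι c * a = a * ι c)
    (ρ : ↥G →* A) (hcent : ∀ a : A, (∀ g, ρ g * a = a * ρ g) → ∃ c, a = ι c)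
    (hconj : ∀ x : Gt, ∃ a : A, ∀ g, a * ρ (conjHom Gt G x g) = ρ g * a) :
    ∃ R : Gt →* A, ∀ g : ↥G, R ↑g = ρ g := by
  obtain ⟨Φ, hΦconj, hΦmul⟩ : ∃ Φ : Gt → A,
      (∀ x g, Φ x * ρ (conjHom Gt G x g) = ρ g * Φ x) ∧
      ∀ (x : Gt) (g : ↥G), Φ (x * ↑g) = Φ x * ρ g := by
    choose Φ₀ hΦ₀ using hconj
    have hmem : ∀ x : Gt, (QuotientGroup.mk x : Gt ⧸ G).out⁻¹ * x ∈ G := fun x =>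
      QuotientGroup.eq.1 (Quotient.out_eq' _)
    refine ⟨fun x => Φ₀ (QuotientGroup.mk x : Gt ⧸ G).out * ρ ⟨_, hmem x⟩, fun x g => ?_,
      fun x g => ?_⟩
    · rw [mul_assoc, ← map_mul, ← mul_assoc, ← hΦ₀, mul_assoc, ← map_mul]
      congr 2
      apply Subtype.ext
      simp [conjHom, mul_assoc]
    · have hq : (QuotientGroup.mk (x * ↑g) : Gt ⧸ G) = QuotientGroup.mk x := by simp
      have hs : (⟨_, hmem (x * ↑g)⟩ : ↥G) = ⟨_, hmem x⟩ * g := by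
        apply Subtype.ext
        simp [mul_assoc]
      simp only [hs, map_mul, mul_assoc]
      rw [hq]
  have hΦmul' : ∀ (g : ↥G) (x : Gt), Φ (↑g * x) = ρ g * Φ x := fun g x => by
    rw [← hΦconj, ← hΦmul]
    congr 1
    simp [conjHom, mul_assoc]
  have hcocycle : ∀ x y, ∃ c, Φ x * Φ y = ι c * Φ (x * y) := fun x y => by
    obtain ⟨c, hc⟩ := hcent (Φ x * Φ y * (Φ (x * y))⁻¹) fun g => by
      have h : ρ g * (Φ x * Φ y) = Φ x * Φ y * ρ (conjHom Gt G (x * y) g) := by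
        rw [← mul_assoc, ← hΦconj, mul_assoc, ← hΦconj, ← mul_assoc]
        congr 2
        apply Subtype.ext
        simp [conjHom, mul_assoc]
      have h' := hΦconj (x * y) g
      rw [← mul_assoc, h, mul_assoc, mul_assoc (Φ x * Φ y)]
      congr 1
      rw [eq_inv_mul_iff_mul_eq, ← mul_assoc, h', mul_inv_cancel_right]
    exact ⟨c, by rw [← hc, inv_mul_cancel_right]⟩
  choose α₀ hα₀ using hcocycle
  have hα : ∀ x y, Φ x * Φ y =
      ι (α₀ (QuotientGroup.mk x : Gt ⧸ G).out (QuotientGroup.mk y : Gt ⧸ G).out) *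
        Φ (x * y) := fun x y => by
    obtain ⟨g, hg⟩ := QuotientGroup.mk_out_eq_mul G x
    obtain ⟨h, hh⟩ := QuotientGroup.mk_out_eq_mul G y
    have key := hα₀ (QuotientGroup.mk x : Gt ⧸ G).out (QuotientGroup.mk y : Gt ⧸ G).out
    generalize α₀ _ _ = c at key ⊢
    rw [hg, hh, hΦmul, mul_assoc, ← hΦmul', ← mul_assoc (↑g : Gt), hΦmul, ← mul_assoc (Φ x),
      ← mul_assoc, hΦmul, ← mul_assoc] at key
    have key' := mul_right_cancel key
    have hgy : ↑g * y = y * ↑(conjHom Gt G y g) := by simp [conjHom, mul_assoc]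
    rw [mul_assoc x, hgy, hΦmul, ← mul_assoc (Φ x), ← mul_assoc x y, hΦmul, ← mul_assoc] at key'
    exact mul_right_cancel key'
  obtain ⟨β, hβ⟩ := hH2 (fun a b => α₀ a.out b.out) fun a b c => by
    induction a using QuotientGroup.induction_on with | H x => ?_
    induction b using QuotientGroup.induction_on with | H y => ?_
    induction c using QuotientGroup.induction_on with | H z => ?_
    apply hι
    apply mul_right_cancel (b := Φ (x * y * z))
    have h₁ := hα (x * y) z
    have h₂ := hα x (y * z)
    rw [QuotientGroup.mk_mul] at h₁ h₂
    rw [map_mul, map_mul, mul_assoc (ι _) (ι _), mul_assoc (ι _) (ι _), ← h₁,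
      ← mul_assoc (ι _), ← hα, mul_assoc x, ← h₂, mul_assoc (Φ x), hα y z, ← mul_assoc (Φ x),
      ← hcentral, mul_assoc]
  have hR : ∀ x y : Gt, ι (β (QuotientGroup.mk (x * y) : Gt ⧸ G))⁻¹ * Φ (x * y) =
      ι (β (QuotientGroup.mk x : Gt ⧸ G))⁻¹ * Φ x *
        (ι (β (QuotientGroup.mk y : Gt ⧸ G))⁻¹ * Φ y) := fun x y => by
    rw [mul_assoc, ← mul_assoc (Φ x), ← hcentral, mul_assoc _ (Φ x), hα, hβ, QuotientGroup.mk_mul]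
    simp only [← mul_assoc, ← map_mul]
    congr 2
    rw [← mul_inv, inv_mul_eq_div, mul_comm (β _) (β _), ← inv_mul_eq_div]
    simp [mul_comm]
  let R : Gt →* A := MonoidHom.mk' (fun x => ι (β (QuotientGroup.mk x : Gt ⧸ G))⁻¹ * Φ x) hR
  refine ⟨R, fun g => ?_⟩
  have h : R (1 * ↑g) = R 1 * ρ g := by
    simp only [R, MonoidHom.mk'_apply]
    rw [hΦmul, mul_assoc]
    congr 4
    simp
  rwa [one_mul, map_one, one_mul] at h

end GroupExtension

section GroupAlgebraModules

variable {k : Type} [Field k]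

section OneGroup

variable {A B : Type} [Group A] [Group B]

@[simp]
theorem mapAlong_of (f : A →* B) (a : A) :
    MapAlong k f (MonoidAlgebra.of k A a) = MonoidAlgebra.of k B (f a) := by
  simp [MapAlong]

theorem mapAlong_smul (f : A →* B) (c : k) (a : MonoidAlgebra k A) :
    MapAlong k f (c • a) = c • MapAlong k f a := by
  simp [MapAlong]

variable {U W : Type} [AddCommGroup U] [Module k U] [Module (MonoidAlgebra k A) U]
  [IsScalarTower k (MonoidAlgebra k A) U] [AddCommGroup W] [Module k W]

theorem of_smul_smul_comm (x : A) (c : k) (u : U) :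
    MonoidAlgebra.of k A x • c • u = c • MonoidAlgebra.of k A x • u :=
  (smul_comm c _ u).symm

variable (k A U) in
/-- The action of group elements on a `kA`-module by `k`-linear automorphisms. -/
noncomputable def groupAut : A →* (U ≃ₗ[k] U) where
  toFun x :=
    { toFun u := MonoidAlgebra.of k A x • u
      invFun u := MonoidAlgebra.of k A x⁻¹ • u
      map_add' := smul_add _
      map_smul' c u := of_smul_smul_comm x c u
      left_inv u := by
        change MonoidAlgebra.of k A x⁻¹ • MonoidAlgebra.of k A x • u = u
        rw [smul_smul, ← map_mul, inv_mul_cancel, map_one, one_smul]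
      right_inv u := by
        change MonoidAlgebra.of k A x • MonoidAlgebra.of k A x⁻¹ • u = u
        rw [smul_smul, ← map_mul, mul_inv_cancel, map_one, one_smul] }
  map_one' := by
    ext u
    change MonoidAlgebra.of k A 1 • u = u
    rw [map_one, one_smul]
  map_mul' x y := by
    ext u
    change MonoidAlgebra.of k A (x * y) • u = MonoidAlgebra.of k A x • MonoidAlgebra.of k A y • u
    rw [map_mul, mul_smul]

theorem groupAut_apply (x : A) (u : U) : groupAut k A U x u = MonoidAlgebra.of k A x • u := rfl

/-- The bundled `kA`-module given by an action of `A` by `k`-linear endomorphisms. -/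
noncomputable def BModule.ofRep (ρ : A →* Module.End k W) : BModule k (MonoidAlgebra k A) :=
  letI : Module (MonoidAlgebra k A) W :=
    Module.compHom W (MonoidAlgebra.lift k (Module.End k W) A ρ).toRingHom
  haveI : IsScalarTower k (MonoidAlgebra k A) W := ⟨fun c a w => by
    change MonoidAlgebra.lift k (Module.End k W) A ρ (c • a) w =
      c • MonoidAlgebra.lift k (Module.End k W) A ρ a w
    rw [map_smul, LinearMap.smul_apply]⟩
  ⟨W⟩

/-- The identification of a `k`-space carrying a group action with the underlying space of the
bundled module it defines. -/
noncomputable def BModule.ofRepEquiv (ρ : A →* Module.End k W) : W ≃ₗ[k] BModule.ofRep ρ :=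
  LinearEquiv.refl k W

theorem BModule.of_smul_ofRepEquiv (ρ : A →* Module.End k W) (x : A) (w : W) :
    MonoidAlgebra.of k A x • BModule.ofRepEquiv ρ w = BModule.ofRepEquiv ρ (ρ x w) := by
  change MonoidAlgebra.lift k (Module.End k W) A ρ (MonoidAlgebra.of k A x) w = ρ x w
  rw [MonoidAlgebra.lift_of]

variable [Module (MonoidAlgebra k A) W] [IsScalarTower k (MonoidAlgebra k A) W]

theorem nonempty_linearEquiv_of_comm (τ : U ≃ₗ[k] W)
    (h : ∀ (x : A) u, τ (MonoidAlgebra.of k A x • u) = MonoidAlgebra.of k A x • τ u) :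
    Nonempty (U ≃ₗ[MonoidAlgebra k A] W) :=
  ⟨LinearEquiv.ofBijective
    (MonoidAlgebra.equivariantOfLinearOfComm (τ : U →ₗ[k] W) h) τ.bijective⟩

/-- The `k`-linear equivalence underlying a `kA`-linear one. -/
noncomputable def restrictEquiv (f : U ≃ₗ[MonoidAlgebra k A] W) : U ≃ₗ[k] W :=
  f.restrictScalars k

theorem exists_scalar_of_isBrickOver (hU : IsBrickOver k (MonoidAlgebra k A) U) (f : U →ₗ[k] U)
    (hf : ∀ (x : A) u, f (MonoidAlgebra.of k A x • u) = MonoidAlgebra.of k A x • f u) :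
    ∃ c : k, ∀ u, f u = c • u := by
  obtain ⟨c, hc⟩ := hU.2 (MonoidAlgebra.equivariantOfLinearOfComm f hf)
  exact ⟨c, fun u => (hc u).trans (algebraMap_smul _ c u)⟩

end OneGroup

section Restriction

variable {A B : Type} [Group A] [Group B]
  {U : Type} [AddCommGroup U] [Module k U] [Module (MonoidAlgebra k A) U]
  [IsScalarTower k (MonoidAlgebra k A) U]
  {W : Type} [AddCommGroup W] [Module k W] [Module (MonoidAlgebra k B) W]
  [IsScalarTower k (MonoidAlgebra k B) W]

theorem extendsAlong_iff (f : A →* B) :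
    ExtendsAlong k f U W ↔ ∃ φ : U ≃ₗ[k] W,
      ∀ (x : A) u, φ (MonoidAlgebra.of k A x • u) = MonoidAlgebra.of k B (f x) • φ u := by
  constructor
  · rintro ⟨φ, hφ⟩
    refine ⟨φ.toLinearEquiv fun c u => ?_, fun x u => ?_⟩
    · have h := hφ (c • 1) u
      rwa [mapAlong_smul, map_one, smul_assoc, smul_assoc, one_smul, one_smul] at h
    · exact (hφ _ u).trans (by rw [mapAlong_of]; rfl)
  · rintro ⟨φ, hφ⟩
    refine ⟨φ.toAddEquiv, fun a => ?_⟩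
    induction a using MonoidAlgebra.induction_on with
    | of x => intro u; rw [mapAlong_of]; exact hφ x u
    | add a b ha hb => intro u; rw [add_smul, map_add, ha, hb, map_add, add_smul]
    | smul c a ha =>
      intro u
      rw [mapAlong_smul, smul_assoc, smul_assoc, ← ha]
      exact map_smul φ c _

end Restriction

section Twist

variable {Gt : Type} [Group Gt] {G : Subgroup Gt} [G.Normal]

/-- `W₂` is the twist of `W₁` by the linear character `χ` of `Gt/G`. -/
def IsTwist (χ : Gt ⧸ G →* k)
    (W₁ : Type) [AddCommGroup W₁] [Module k W₁] [Module (MonoidAlgebra k Gt) W₁]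
    (W₂ : Type) [AddCommGroup W₂] [Module k W₂] [Module (MonoidAlgebra k Gt) W₂] : Prop :=
  ∃ τ : W₁ ≃ₗ[k] W₂, ∀ (x : Gt) (w : W₁),
    MonoidAlgebra.of k Gt x • τ w =
      χ (QuotientGroup.mk x) • τ (MonoidAlgebra.of k Gt x • w)

/-- `V` is one-dimensional and the group acts on it through the linear character `χ`. -/
def AffordsChar {Q : Type} [Group Q] (χ : Q →* k)
    (V : Type) [AddCommGroup V] [Module k V] [Module (MonoidAlgebra k Q) V] : Prop :=
  OneDimOver k V ∧ ∀ q (v : V), MonoidAlgebra.of k Q q • v = χ q • v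

section AffordsChar

variable {Q : Type} [Group Q]
  {V : Type} [AddCommGroup V] [Module k V] [Module (MonoidAlgebra k Q) V]
  [IsScalarTower k (MonoidAlgebra k Q) V]
  {V' : Type} [AddCommGroup V'] [Module k V'] [Module (MonoidAlgebra k Q) V']
  [IsScalarTower k (MonoidAlgebra k Q) V']

theorem exists_affordsChar (hV : OneDimOver k V) : ∃ χ : Q →* k, AffordsChar χ V := by
  obtain ⟨v, hv, hspan⟩ := hV
  choose χ hχ using fun q : Q => hspan (MonoidAlgebra.of k Q q • v)
  have hχ' : ∀ q (w : V), MonoidAlgebra.of k Q q • w = χ q • w := fun q w => by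
    obtain ⟨c, rfl⟩ := hspan w
    rw [of_smul_smul_comm, hχ, smul_comm]
  refine ⟨⟨⟨χ, ?_⟩, fun q r => ?_⟩, ⟨v, hv, hspan⟩, hχ'⟩
  · apply smul_left_injective k hv
    change χ 1 • v = (1 : k) • v
    rw [← hχ, map_one, one_smul, one_smul]
  · apply smul_left_injective k hv
    change χ (q * r) • v = (χ q * χ r) • v
    rw [← hχ, map_mul, mul_smul, mul_smul, hχ' r, hχ' q]

theorem OneDimOver.exists_linearEquiv (hV : OneDimOver k V) : Nonempty (V ≃ₗ[k] k) := by
  obtain ⟨v, hv, hspan⟩ := hV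
  refine ⟨(LinearEquiv.ofBijective (LinearMap.toSpanSingleton k V v)
    ⟨smul_left_injective k hv, fun w => ?_⟩).symm⟩
  obtain ⟨c, hc⟩ := hspan w
  exact ⟨c, hc.symm⟩

theorem AffordsChar.nonempty_linearEquiv {χ : Q →* k} (hV : AffordsChar χ V)
    (hV' : AffordsChar χ V') : Nonempty (V ≃ₗ[MonoidAlgebra k Q] V') := by
  obtain ⟨e⟩ := hV.1.exists_linearEquiv
  obtain ⟨e'⟩ := hV'.1.exists_linearEquiv
  refine nonempty_linearEquiv_of_comm (e.trans e'.symm) fun q v => ?_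
  rw [hV.2, hV'.2, map_smul]

theorem AffordsChar.unique_of_linearEquiv {χ χ' : Q →* k} (hV : AffordsChar χ V)
    (hV' : AffordsChar χ' V') (f : V ≃ₗ[MonoidAlgebra k Q] V') : χ = χ' := by
  obtain ⟨v, hv, -⟩ := hV.1
  ext q
  apply smul_left_injective k (show f v ≠ 0 by simpa using hv)
  change χ q • f v = χ' q • f v
  rw [← hV'.2, ← map_smul f (MonoidAlgebra.of k Q q), hV.2]
  exact (map_smul (restrictEquiv f) (χ q) v).symm

/-- The one-dimensional module affording a given linear character. -/
noncomputable def charModule (χ : Q →* k) : BModule k (MonoidAlgebra k Q) :=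
  BModule.ofRep ((algebraMap k (Module.End k k)).toMonoidHom.comp χ)

theorem affordsChar_charModule (χ : Q →* k) : AffordsChar χ (charModule χ) :=
  ⟨(⟨1, one_ne_zero, fun c => ⟨c, (mul_one c).symm⟩⟩ : OneDimOver k k),
    fun q v => BModule.of_smul_ofRepEquiv _ q v⟩

end AffordsChar

variable {W₁ : Type} [AddCommGroup W₁] [Module k W₁] [Module (MonoidAlgebra k Gt) W₁]
  {W₂ : Type} [AddCommGroup W₂] [Module k W₂] [Module (MonoidAlgebra k Gt) W₂]
  [IsScalarTower k (MonoidAlgebra k Gt) W₂]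
  {W₃ : Type} [AddCommGroup W₃] [Module k W₃] [Module (MonoidAlgebra k Gt) W₃]
  [IsScalarTower k (MonoidAlgebra k Gt) W₃]

theorem IsTwist.nonempty_linearEquiv {χ : Gt ⧸ G →* k} (h₂ : IsTwist χ W₁ W₂)
    (h₃ : IsTwist χ W₁ W₃) : Nonempty (W₂ ≃ₗ[MonoidAlgebra k Gt] W₃) := by
  obtain ⟨τ, hτ⟩ := h₂
  obtain ⟨σ, hσ⟩ := h₃
  refine nonempty_linearEquiv_of_comm (τ.symm.trans σ) fun x w => ?_
  obtain ⟨w, rfl⟩ := τ.surjective w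
  simp only [LinearEquiv.trans_apply, LinearEquiv.symm_apply_apply]
  rw [hτ, hσ, map_smul, map_smul, LinearEquiv.symm_apply_apply]

theorem IsTwist.trans_linearEquiv {χ : Gt ⧸ G →* k} (h₂ : IsTwist χ W₁ W₂)
    (f : W₂ ≃ₗ[MonoidAlgebra k Gt] W₃) : IsTwist χ W₁ W₃ := by
  obtain ⟨τ, hτ⟩ := h₂
  refine ⟨τ.trans (restrictEquiv f), fun x w => ?_⟩
  have h := congrArg f (hτ x w)
  rw [map_smul] at h
  exact h.trans (map_smul (restrictEquiv f) _ _)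

variable [IsScalarTower k (MonoidAlgebra k Gt) W₁]

theorem diagTensorIso_iff_isTwist {χ : Gt ⧸ G →* k}
    {V : Type} [AddCommGroup V] [Module k V] [Module (MonoidAlgebra k (Gt ⧸ G)) V]
    [IsScalarTower k (MonoidAlgebra k (Gt ⧸ G)) V] (hV : AffordsChar χ V) :
    DiagTensorIso k Gt G W₁ V W₂ ↔ IsTwist χ W₁ W₂ := by
  obtain ⟨e⟩ := hV.1.exists_linearEquiv
  obtain ⟨E, hE⟩ : ∃ E : (W₁ ⊗[k] V) ≃ₗ[k] W₁, ∀ w v, E (w ⊗ₜ[k] v) = e v • w :=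
    ⟨(TensorProduct.congr (LinearEquiv.refl k W₁) e).trans (TensorProduct.rid k W₁),
      fun w v => by simp⟩
  constructor
  · rintro ⟨θ, hθ⟩
    refine ⟨E.symm.trans θ, fun x w => ?_⟩
    have hE' : ∀ w, E.symm w = w ⊗ₜ[k] e.symm 1 := fun w => by
      rw [LinearEquiv.symm_apply_eq, hE, LinearEquiv.apply_symm_apply, one_smul]
    rw [LinearEquiv.trans_apply, LinearEquiv.trans_apply, hE', hE', ← hθ, hV.2,
      TensorProduct.tmul_smul, map_smul]
  · rintro ⟨τ, hτ⟩
    refine ⟨E.trans τ, fun x w v => ?_⟩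
    rw [LinearEquiv.trans_apply, LinearEquiv.trans_apply, hE, hE, hV.2, map_smul e,
      map_smul τ (e v) w, of_smul_smul_comm, hτ, smul_smul, map_smul τ, smul_eq_mul, mul_comm]

variable {S : Type} [AddCommGroup S] [Module k S] [Module (MonoidAlgebra k ↥G) S]
  [IsScalarTower k (MonoidAlgebra k ↥G) S]

theorem exists_isTwist (hS : IsBrickOver k (MonoidAlgebra k ↥G) S)
    (h₁ : ExtendsAlong k G.subtype S W₁) (h₂ : ExtendsAlong k G.subtype S W₂) :
    ∃ χ : Gt ⧸ G →* k, IsTwist χ W₁ W₂ := by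
  obtain ⟨φ₁, h₁⟩ := (extendsAlong_iff _).1 h₁
  obtain ⟨φ₂, h₂⟩ := (extendsAlong_iff _).1 h₂
  obtain ⟨τ, hφ, hτ⟩ : ∃ τ : W₁ ≃ₗ[k] W₂, (∀ s, τ (φ₁ s) = φ₂ s) ∧ ∀ (g : ↥G) w,
      τ (MonoidAlgebra.of k Gt ↑g • w) = MonoidAlgebra.of k Gt ↑g • τ w := by
    refine ⟨φ₁.symm.trans φ₂, fun s => by simp, fun g w => ?_⟩
    obtain ⟨s, rfl⟩ := φ₁.surjective w
    have h := h₁ g s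
    rw [Subgroup.subtype_apply] at h
    simp only [LinearEquiv.trans_apply, ← h, LinearEquiv.symm_apply_apply]
    exact h₂ g s
  have hscalar : ∀ x : Gt, ∃ c : k, ∀ w, MonoidAlgebra.of k Gt x • τ w =
      c • τ (MonoidAlgebra.of k Gt x • w) := fun x => by
    let a₁ := groupAut k Gt W₁
    let a₂ := groupAut k Gt W₂
    obtain ⟨c, hc⟩ := exists_scalar_of_isBrickOver hS
      (φ₁ ≪≫ₗ (a₁ x)⁻¹ ≪≫ₗ τ ≪≫ₗ a₂ x ≪≫ₗ φ₂.symm).toLinearMap fun g s => by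
        have hx : x⁻¹ * ↑g = ↑(conjHom Gt G x g) * x⁻¹ := by simp [conjHom]
        have hx' : x * ↑(conjHom Gt G x g) = ↑g * x := by simp [conjHom, mul_assoc]
        apply φ₂.injective
        simp only [LinearEquiv.coe_coe, LinearEquiv.trans_apply, LinearEquiv.apply_symm_apply]
        rw [h₂, LinearEquiv.apply_symm_apply, h₁]
        simp only [a₁, a₂, ← map_inv, groupAut_apply, Subgroup.subtype_apply]
        rw [smul_smul, ← map_mul, hx, map_mul, mul_smul, hτ, smul_smul, ← map_mul, hx', map_mul,
          mul_smul]
    refine ⟨c, fun w => ?_⟩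
    obtain ⟨s, hs⟩ := φ₁.surjective (MonoidAlgebra.of k Gt x • w)
    have h := congrArg φ₂ (hc s)
    simp only [LinearEquiv.coe_coe, LinearEquiv.trans_apply, LinearEquiv.apply_symm_apply, hs]
      at h
    rw [map_smul φ₂ c s, ← hφ, hs] at h
    simp only [a₁, a₂, ← map_inv, groupAut_apply] at h
    rwa [smul_smul (MonoidAlgebra.of k Gt x⁻¹), ← map_mul, inv_mul_cancel, map_one,
      one_smul] at h
  choose χ hχ using hscalar
  obtain ⟨s, hs⟩ := (have := hS.1; exists_ne (0 : S))
  have huniq : ∀ (x : Gt) (c : k), (∀ w, MonoidAlgebra.of k Gt x • τ w =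
      c • τ (MonoidAlgebra.of k Gt x • w)) → χ x = c := fun x c hc => by
    have h := (hχ x ((groupAut k Gt W₁ x)⁻¹ (φ₁ s))).symm.trans (hc _)
    rw [← groupAut_apply, ← LinearEquiv.mul_apply, mul_inv_cancel, LinearEquiv.coe_one, id] at h
    exact smul_left_injective k (by simpa using hs) h
  let χ' : Gt →* k :=
    { toFun := χ
      map_one' := huniq 1 1 fun w => by rw [map_one, one_smul, one_smul, one_smul]
      map_mul' x y := huniq _ _ fun w => by
        rw [map_mul, mul_smul, mul_smul (MonoidAlgebra.of k Gt x) _ w, hχ, of_smul_smul_comm, hχ,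
          smul_smul, mul_comm] }
  exact ⟨QuotientGroup.lift G χ' fun g hg => huniq g 1 fun w => by
    rw [one_smul]; exact (hτ ⟨g, hg⟩ w).symm, τ, hχ⟩

theorem IsTwist.char_unique (hS : IsBrickOver k (MonoidAlgebra k ↥G) S)
    (h₁ : ExtendsAlong k G.subtype S W₁) {χ χ' : Gt ⧸ G →* k} (h : IsTwist χ W₁ W₂)
    (h' : IsTwist χ' W₁ W₂) : χ = χ' := by
  obtain ⟨φ, hφ⟩ := (extendsAlong_iff _).1 h₁
  obtain ⟨τ, hτ⟩ := h
  obtain ⟨σ, hσ⟩ := h'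
  have hG : ∀ (ψ : Gt ⧸ G →* k) (g : ↥G), ψ (QuotientGroup.mk ↑g) = 1 := fun ψ g => by
    rw [(QuotientGroup.eq_one_iff (g : Gt)).2 g.2, map_one]
  obtain ⟨c, hc⟩ := exists_scalar_of_isBrickOver hS
    (φ ≪≫ₗ σ ≪≫ₗ τ.symm ≪≫ₗ φ.symm).toLinearMap fun g s => by
      have hσ' := hσ ↑g (φ s)
      have hτ' := hτ ↑g (τ.symm (σ (φ s)))
      rw [hG, one_smul] at hσ' hτ'
      apply φ.injective
      apply τ.injective
      simp only [LinearEquiv.coe_coe, LinearEquiv.trans_apply, LinearEquiv.apply_symm_apply]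
      rw [hφ, hφ, LinearEquiv.apply_symm_apply, Subgroup.subtype_apply, ← hσ', ← hτ',
        LinearEquiv.apply_symm_apply]
  have hc' : ∀ w, σ w = c • τ w := fun w => by
    obtain ⟨s, rfl⟩ := φ.surjective w
    have h := congrArg (fun s => τ (φ s)) (hc s)
    simpa using h
  obtain ⟨s, hs⟩ := (have := hS.1; exists_ne (0 : S))
  ext x
  have hx := hσ x ((groupAut k Gt W₁ x)⁻¹ (φ s))
  rw [hc', of_smul_smul_comm, hτ, ← groupAut_apply, ← LinearEquiv.mul_apply, mul_inv_cancel,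
    LinearEquiv.coe_one, id, smul_comm, ← hc'] at hx
  exact smul_left_injective k (by simpa using hs) hx

theorem exists_isTwist_extendsAlong (h₁ : ExtendsAlong k G.subtype S W₁) (χ : Gt ⧸ G →* k) :
    ∃ W : BModule k (MonoidAlgebra k Gt), ExtendsAlong k G.subtype S W ∧ IsTwist χ W₁ W := by
  let ρ : Gt →* Module.End k W₁ :=
    { toFun x := χ (QuotientGroup.mk x) • (groupAut k Gt W₁ x).toLinearMap
      map_one' := by
        rw [QuotientGroup.mk_one, map_one, map_one, one_smul]
        rfl
      map_mul' x y := by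
        ext w
        change _ = χ _ • groupAut k Gt W₁ x (χ _ • groupAut k Gt W₁ y w)
        rw [QuotientGroup.mk_mul, map_mul, map_mul, map_smul, smul_smul]
        rfl }
  have hρ : ∀ x (w : W₁), ρ x w = χ (QuotientGroup.mk x) • MonoidAlgebra.of k Gt x • w :=
    fun _ _ => rfl
  refine ⟨BModule.ofRep ρ, ?_, BModule.ofRepEquiv ρ, fun x w => ?_⟩
  · obtain ⟨φ, hφ⟩ := (extendsAlong_iff _).1 h₁
    refine (extendsAlong_iff _).2 ⟨φ.trans (BModule.ofRepEquiv ρ), fun g s => ?_⟩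
    rw [LinearEquiv.trans_apply, LinearEquiv.trans_apply, hφ, BModule.of_smul_ofRepEquiv, hρ, Subgroup.subtype_apply,
      (QuotientGroup.eq_one_iff (g : Gt)).2 g.2, map_one, one_smul]
  · rw [BModule.of_smul_ofRepEquiv, hρ, map_smul]

theorem exists_extendsAlong (hS : IsBrickOver k (MonoidAlgebra k ↥G) S)
    (hstable : IsGtStable k Gt G S) (hH2 : H2Trivial k (Gt ⧸ G)) :
    ∃ W : BModule k (MonoidAlgebra k Gt), ExtendsAlong k G.subtype S W := by
  obtain ⟨s, hs⟩ := (have := hS.1; exists_ne (0 : S))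
  let ι : kˣ →* (S ≃ₗ[k] S) := DistribMulAction.toModuleAut k S
  have hι : ∀ (c : kˣ) (u : S), ι c u = (c : k) • u := fun _ _ => rfl
  obtain ⟨R, hR⟩ := exists_extension_of_H2Trivial hH2 ι
    (fun c d h => Units.ext (smul_left_injective k hs (LinearEquiv.congr_fun h s)))
    (fun c a => LinearEquiv.ext fun u => (map_smul a (c : k) u).symm)
    (groupAut k ↥G S)
    (fun a ha => by
      obtain ⟨c, hc⟩ := exists_scalar_of_isBrickOver hS a.toLinearMap fun g u =>
        (LinearEquiv.congr_fun (ha g) u).symm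
      have hc0 : c ≠ 0 := by
        rintro rfl
        exact hs (a.injective ((hc s).trans (by rw [zero_smul, map_zero])))
      exact ⟨Units.mk0 c hc0, LinearEquiv.ext hc⟩)
    (fun x => by
      obtain ⟨ψ, hψ⟩ := hstable x
      refine ⟨ψ.toLinearEquiv fun c u => ?_, fun g => LinearEquiv.ext fun u => ?_⟩
      · have h := hψ (c • 1) u
        rwa [mapAlong_smul, map_one, smul_assoc, smul_assoc, one_smul, one_smul] at h
      · have h := hψ (MonoidAlgebra.of k ↥G g) u
        rwa [mapAlong_of] at h)
  let ρ := LinearEquiv.automorphismGroup.toLinearMapMonoidHom.comp R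
  refine ⟨BModule.ofRep ρ, (extendsAlong_iff _).2 ⟨BModule.ofRepEquiv ρ, fun g u => ?_⟩⟩
  rw [BModule.of_smul_ofRepEquiv]
  exact congrArg (BModule.ofRepEquiv ρ) (LinearEquiv.congr_fun (hR g) u).symm

end Twist

end GroupAlgebraModules

/-- For a `G̃`-stable brick `S` with `H²(G̃/G, kˣ)` trivial, any two
extending `k[G̃]`-modules differ by tensoring with a unique one-dimensional
`k[G̃/G]`-module, and the number of isomorphism classes of extending modules equals
the number `e` of isomorphism classes of one-dimensional `k[G̃/G]`-modules. -/
theorem statement_5 (k : Type) [Field k] [IsAlgClosed k]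
    (Gt : Type) [Group Gt] [Finite Gt] (G : Subgroup Gt) [G.Normal]
    (S : Type) [AddCommGroup S] [Module (MonoidAlgebra k ↥G) S]
    [Module.Finite (MonoidAlgebra k ↥G) S]
    (hbrick : IsBrickOver k (MonoidAlgebra k ↥G) S)
    (hstable : IsGtStable k Gt G S)
    (hH2 : H2Trivial k (Gt ⧸ G))
    (e : ℕ)
    (he : RepClasses k (MonoidAlgebra k (Gt ⧸ G)) (fun V => OneDimOver k ↥V) e) :
    (∀ W₁ W₂ : BModule k (MonoidAlgebra k Gt),
        ExtendsAlong k G.subtype S ↥W₁ → ExtendsAlong k G.subtype S ↥W₂ →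
        ∃ V : BModule k (MonoidAlgebra k (Gt ⧸ G)), OneDimOver k ↥V ∧
          DiagTensorIso k Gt G ↥W₁ ↥V ↥W₂ ∧
          ∀ V' : BModule k (MonoidAlgebra k (Gt ⧸ G)), OneDimOver k ↥V' →
            DiagTensorIso k Gt G ↥W₁ ↥V' ↥W₂ →
            Nonempty (↥V ≃ₗ[MonoidAlgebra k (Gt ⧸ G)] ↥V')) ∧
    RepClasses k (MonoidAlgebra k Gt)
      (fun W => ExtendsAlong k G.subtype S ↥W) e := by
  let : Module k S := Module.compHom S (algebraMap k (MonoidAlgebra k ↥G))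
  have : IsScalarTower k (MonoidAlgebra k ↥G) S :=
    IsScalarTower.of_algebraMap_smul fun _ _ => rfl
  constructor
  · intro W₁ W₂ h₁ h₂
    obtain ⟨χ, hχ⟩ := exists_isTwist hbrick h₁ h₂
    have hV := affordsChar_charModule χ
    refine ⟨charModule χ, hV.1, (diagTensorIso_iff_isTwist hV).2 hχ, fun V' hV' h => ?_⟩
    obtain ⟨χ', hχ'⟩ := exists_affordsChar (Q := Gt ⧸ G) hV'
    obtain rfl : χ = χ' := hχ.char_unique hbrick h₁ ((diagTensorIso_iff_isTwist hχ').1 h)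
    exact hV.nonempty_linearEquiv hχ'
  · obtain ⟨V, hV, hne, hall⟩ := he
    obtain ⟨W₀, hW₀⟩ := exists_extendsAlong hbrick hstable hH2
    choose χ hχ using fun i => exists_affordsChar (Q := Gt ⧸ G) (hV i)
    choose W hW htwist using fun i => exists_isTwist_extendsAlong hW₀ (χ i)
    refine ⟨W, hW, fun i j hij => ⟨fun f => ?_⟩, fun X hX => ?_⟩
    · have hij' : χ i = χ j :=
        ((htwist i).trans_linearEquiv f).char_unique hbrick hW₀ (htwist j)
      have hi := hχ i
      rw [hij'] at hi
      exact (hne i j hij).elim (hi.nonempty_linearEquiv (hχ j)).some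
    · obtain ⟨ψ, hψ⟩ := exists_isTwist hbrick hW₀ hX
      obtain ⟨i, ⟨f⟩⟩ := hall (charModule ψ) (affordsChar_charModule ψ).1
      obtain rfl : ψ = χ i := (affordsChar_charModule ψ).unique_of_linearEquiv (hχ i) f
      exact ⟨i, hψ.nonempty_linearEquiv (htwist i)⟩

end Paper
end
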